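/- Let Q be a finite quiver without loops, let α be a positive indivisible root of Q, and let Z : K(P(Q)-nil) → ℂ be a central charge which is generic with respect to α. Then there is a stable module in P(Q)-nil with respect to Z whose class is α. -/

import Mathlib

open CategoryTheory Limits Pretriangulated

universe v u

namespace GreenSeqPaper



/-- A finite quiver without loops: finitely many vertices `V` and arrows `A`,
with source and target maps, and no arrow from a vertex to itself. -/
structure LooplessQuiver where
  V : Type
  A : Type
  [fintypeV : Fintype V]
  [decEqV : DecidableEq V]
  [fintypeA : Fintype A]
  src : A → V
  tgt : A → V
  no_loops : ∀ a, src a ≠ tgt a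

attribute [instance] LooplessQuiver.fintypeV LooplessQuiver.decEqV LooplessQuiver.fintypeA

namespace LooplessQuiver

variable (Q : LooplessQuiver)

/-- The arrows of the double quiver `Q̄`: an arrow `a : i ⟶ j` of `Q` (left) together
with a reversed arrow `a* : j ⟶ i` (right). -/
abbrev DArrow := Q.A ⊕ Q.A

/-- Source of an arrow of the double quiver. -/
def dsrc : Q.DArrow → Q.V
  | .inl a => Q.src a
  | .inr a => Q.tgt a

/-- Target of an arrow of the double quiver. -/
def dtgt : Q.DArrow → Q.V
  | .inl a => Q.tgt a
  | .inr a => Q.src a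

/-- Generators of the path algebra of the double quiver: one idempotent `e i` for each
vertex `i` and one generator `x a` for each arrow `a` of the double quiver. -/
abbrev Gen := Q.V ⊕ Q.DArrow

/-- The vertex idempotent `e i` in the free algebra. -/
noncomputable def e (i : Q.V) : FreeAlgebra ℂ Q.Gen := FreeAlgebra.ι ℂ (Sum.inl i)

/-- The arrow generator `x a` in the free algebra. -/
noncomputable def x (a : Q.DArrow) : FreeAlgebra ℂ Q.Gen := FreeAlgebra.ι ℂ (Sum.inr a)

/-- The relations presenting the preprojective algebra `P(Q) = ℂQ̄/(c)`:
the path-algebra relations of the double quiver `Q̄` (orthogonal vertex idempotents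
summing to `1`, compatibility of arrows with their endpoints), together with the
preprojective relation `c = Σ_{a ∈ Q₁} (a a* - a* a) = 0`. -/
inductive Rel : FreeAlgebra ℂ Q.Gen → FreeAlgebra ℂ Q.Gen → Prop
  | vertex_mul (i j : Q.V) : Rel (Q.e i * Q.e j) (if i = j then Q.e i else 0)
  | vertex_sum : Rel (∑ i : Q.V, Q.e i) 1
  | arrow_left (a : Q.DArrow) : Rel (Q.e (Q.dtgt a) * Q.x a) (Q.x a)
  | arrow_right (a : Q.DArrow) : Rel (Q.x a * Q.e (Q.dsrc a)) (Q.x a)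
  | preprojective :
      Rel (∑ a : Q.A, (Q.x (Sum.inl a) * Q.x (Sum.inr a) - Q.x (Sum.inr a) * Q.x (Sum.inl a))) 0

/-- The preprojective algebra `P(Q)` of the quiver `Q`. -/
abbrev Preproj := RingQuot Q.Rel

/-- The image of the vertex idempotent `e i` in `P(Q)`. -/
noncomputable def pe (i : Q.V) : Q.Preproj := RingQuot.mkAlgHom ℂ Q.Rel (Q.e i)

/-- The image of the arrow generator `x a` in `P(Q)`. -/
noncomputable def px (a : Q.DArrow) : Q.Preproj := RingQuot.mkAlgHom ℂ Q.Rel (Q.x a)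

/-- The symmetric bilinear form `(x, y) = 2 Σ_i x_i y_i - Σ_{a : i → j ∈ Q̄₁} x_i y_j`
on the root lattice `ℤQ₀` (the sum runs over the arrows of the double quiver). -/
def form (v w : Q.V → ℤ) : ℤ :=
  2 * ∑ i : Q.V, v i * w i -
    ∑ a : Q.A, (v (Q.src a) * w (Q.tgt a) + v (Q.tgt a) * w (Q.src a))

/-- `Q` is of Dynkin type, i.e. its underlying graph is a disjoint union of ADE Dynkin
diagrams; equivalently, the symmetric bilinear form of `Q` is positive definite. -/
def IsDynkin : Prop := ∀ v : Q.V → ℤ, v ≠ 0 → 0 < Q.form v v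

end LooplessQuiver

section Modules

open ModuleCat

variable (Q : LooplessQuiver)

-- the scoped instances `ModuleCat.moduleOfAlgebraModule` and
-- `ModuleCat.isScalarTower_of_algebra_moduleCat` give each `P(Q)`-module its
-- canonical `ℂ`-vector space structure
attribute [local instance] ModuleCat.moduleOfAlgebraModule
  ModuleCat.isScalarTower_of_algebra_moduleCat

/-- A `P(Q)`-module is finite-dimensional if it is so as a `ℂ`-vector space. -/
def LooplessQuiver.FinDim (M : ModuleCat.{0} Q.Preproj) : Prop := FiniteDimensional ℂ M

/-- A `P(Q)`-module is nilpotent if all sufficiently long products of arrows act by zero;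
equivalently, all its composition factors are the vertex simples `S₁, …, Sₙ`. -/
def LooplessQuiver.IsNilpotentMod (M : ModuleCat.{0} Q.Preproj) : Prop :=
  ∃ N : ℕ, ∀ l : List Q.DArrow, l.length = N → ∀ m : M, (l.map Q.px).prod • m = 0

/-- The dimension of the vector space `eᵢ M` attached to the vertex `i` by the
`P(Q)`-module `M` (viewed as a representation of the double quiver). -/
noncomputable def LooplessQuiver.dimAt (M : ModuleCat.{0} Q.Preproj) (i : Q.V) : ℕ :=
  Module.finrank ℂ (Submodule.span ℂ (Set.range fun m : M => Q.pe i • m))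

/-- The dimension vector of a `P(Q)`-module, as an element of the root lattice `ℤQ₀`. -/
noncomputable def LooplessQuiver.dimVec (M : ModuleCat.{0} Q.Preproj) : Q.V → ℤ :=
  fun i => (Q.dimAt M i : ℤ)

/-- A brick: a module `M` with `Hom(M, M) = ℂ`, i.e. `M` is nonzero and every
endomorphism of `M` is multiplication by a scalar. -/
def LooplessQuiver.IsBrick (M : ModuleCat.{0} Q.Preproj) : Prop :=
  (∃ m : M, m ≠ 0) ∧
    ∀ f : M ⟶ M, ∃ c : ℂ, ∀ m : M, f m = algebraMap ℂ Q.Preproj c • m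

/-- `Ext¹(M, N) = 0` for `P(Q)`-modules. -/
def LooplessQuiver.Ext1Vanishes (M N : ModuleCat.{0} Q.Preproj) : Prop :=
  Subsingleton (((Ext ℂ (ModuleCat.{0} Q.Preproj) 1).obj (Opposite.op M)).obj N)

/-- A module is rigid if `Ext¹(M, M) = 0`. -/
def LooplessQuiver.IsRigid (M : ModuleCat.{0} Q.Preproj) : Prop := Q.Ext1Vanishes M M

/-- `dim_ℂ Extⁿ(M, N)` for `P(Q)`-modules. -/
noncomputable def LooplessQuiver.extDim (n : ℕ) (M N : ModuleCat.{0} Q.Preproj) : ℕ :=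
  Module.finrank ℂ (((Ext ℂ (ModuleCat.{0} Q.Preproj) n).obj (Opposite.op M)).obj N)

/-- `dim_ℂ Hom(M, N)` for `P(Q)`-modules. -/
noncomputable def LooplessQuiver.homDim (M N : ModuleCat.{0} Q.Preproj) : ℕ :=
  Module.finrank ℂ (M ⟶ N)

end Modules

namespace LooplessQuiver

variable (Q : LooplessQuiver)

/-- The simple root attached to the vertex `i`. -/
def simRoot (i : Q.V) : Q.V → ℤ := Pi.single i 1

/-- Two vertices are adjacent if some arrow of `Q` joins them. -/
def Adj (i j : Q.V) : Prop :=
  ∃ a : Q.A, (Q.src a = i ∧ Q.tgt a = j) ∨ (Q.src a = j ∧ Q.tgt a = i)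

/-- The support of `α` is connected in the underlying graph of `Q`. -/
def SuppConnected (α : Q.V → ℤ) : Prop :=
  ∀ i j : Q.V, α i ≠ 0 → α j ≠ 0 →
    Relation.ReflTransGen (fun u v => Q.Adj u v ∧ α u ≠ 0 ∧ α v ≠ 0) i j

/-- The roots of the root lattice of `Q` (Kac): the real roots are the Weyl group
orbits of the simple roots (`simple`, `reflect`), and the imaginary roots are
the orbits of the elements of the fundamental region and their negatives
(`fundamental`, `neg`). -/
inductive IsRoot : (Q.V → ℤ) → Prop
  | simple (i : Q.V) : IsRoot (Q.simRoot i)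
  | reflect (i : Q.V) {α : Q.V → ℤ} :
      IsRoot α → IsRoot (α - Q.form α (Q.simRoot i) • Q.simRoot i)
  | neg {α : Q.V → ℤ} : IsRoot α → IsRoot (-α)
  | fundamental {α : Q.V → ℤ} : α ≠ 0 → (∀ i, 0 ≤ α i) → Q.SuppConnected α →
      (∀ i, Q.form α (Q.simRoot i) ≤ 0) → IsRoot α

/-- A positive root. -/
def IsPositiveRoot (α : Q.V → ℤ) : Prop := Q.IsRoot α ∧ α ≠ 0 ∧ ∀ i, 0 ≤ α i

/-- A root is indivisible if it is not a multiple `m β`, `|m| > 1`, of a root `β`. -/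
def Indivisible (α : Q.V → ℤ) : Prop :=
  ¬ ∃ (m : ℤ) (β : Q.V → ℤ), 1 < |m| ∧ Q.IsRoot β ∧ α = m • β

/-- For a Dynkin quiver the positive roots are the nonnegative vectors of the root
lattice with `(α, α) = 2`. -/
def IsDynkinPositiveRoot (α : Q.V → ℤ) : Prop :=
  (∀ i, 0 ≤ α i) ∧ Q.form α α = 2

end LooplessQuiver

/-- The upper half-plane `H̄ = {r exp(iπφ) : 0 < φ ≤ 1, r > 0}`:
the nonzero complex numbers with argument in `(0, π]`. -/
def UpperHalf (z : ℂ) : Prop := 0 < z.arg ∧ z.arg ≤ Real.pi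

/-- The phase `φ ∈ (0, 1]` of an element of the upper half-plane. -/
noncomputable def phaseOf (z : ℂ) : ℝ := z.arg / Real.pi



section Stability

variable (Q : LooplessQuiver)

/-- A central charge on `P(Q)-nil`, under the identification of the Grothendieck
group `K(P(Q)-nil)` with the root lattice `ℤQ₀` via dimension vectors: an additive
map `Z : ℤQ₀ → ℂ` sending the class of every nonzero nilpotent module (i.e. every
nonzero nonnegative vector) into the upper half-plane `H̄`. -/
structure NilCentralCharge where
  Z : ((Q.V → ℤ) →+ ℂ)
  upper : ∀ α : Q.V → ℤ, (∀ i, 0 ≤ α i) → α ≠ 0 → UpperHalf (Z α)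

variable {Q}

/-- The phase of a nilpotent module with respect to a central charge. -/
noncomputable def NilCentralCharge.phase (Z : NilCentralCharge Q) (α : Q.V → ℤ) : ℝ :=
  phaseOf (Z.Z α)

/-- A module of `P(Q)-nil` is stable with respect to the central charge `Z` if
every proper nonzero submodule has strictly smaller phase. -/
def IsStableMod (Z : NilCentralCharge Q) (M : ModuleCat.{0} Q.Preproj) : Prop :=
  Q.FinDim M ∧ Q.IsNilpotentMod M ∧ (∃ m : M, m ≠ 0) ∧
    ∀ N : Submodule Q.Preproj M, N ≠ ⊥ → N ≠ ⊤ →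
      Z.phase (Q.dimVec (ModuleCat.of Q.Preproj N)) < Z.phase (Q.dimVec M)

/-- A central charge is discrete if different stable modules have different phases. -/
def NilCentralCharge.IsDiscrete (Z : NilCentralCharge Q) : Prop :=
  ∀ M N : ModuleCat.{0} Q.Preproj, IsStableMod Z M → IsStableMod Z N →
    Z.phase (Q.dimVec M) = Z.phase (Q.dimVec N) → Nonempty (M ≃ₗ[Q.Preproj] N)

end Stability

namespace LooplessQuiver

variable {Q : LooplessQuiver}

/-- Operators `e`, `x` on `W` defining a module over the deformed preprojective algebra
`Π^λ`, i.e. a representation of the double quiver with `∑ [x_a, x_{a*}] = ∑ λ_i e_i`. -/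
structure IsDeformedRep (lam : Q.V → ℂ) {W : Type*} [AddCommGroup W] [Module ℂ W]
    (e : Q.V → Module.End ℂ W) (x : Q.DArrow → Module.End ℂ W) : Prop where
  mul : ∀ i j, e i * e j = if i = j then e i else 0
  sum : ∑ i, e i = 1
  left : ∀ a, e (Q.dtgt a) * x a = x a
  right : ∀ a, x a * e (Q.dsrc a) = x a
  rel : ∑ a : Q.A, (x (Sum.inl a) * x (Sum.inr a) - x (Sum.inr a) * x (Sum.inl a)) =
    ∑ i, lam i • e i

/-- A subspace stable under the vertex idempotents and the arrows. -/
def IsSubrep {W : Type*} [AddCommGroup W] [Module ℂ W]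
    (e : Q.V → Module.End ℂ W) (x : Q.DArrow → Module.End ℂ W) (S : Submodule ℂ W) : Prop :=
  (∀ i, ∀ w ∈ S, e i w ∈ S) ∧ ∀ a, ∀ w ∈ S, x a w ∈ S

namespace IsDeformedRep

variable {X : Type} [AddCommGroup X] [Module ℂ X]
  {e : Q.V → Module.End ℂ X} {x : Q.DArrow → Module.End ℂ X}

/-- The action of the free algebra factors through the preprojective algebra. -/
noncomputable def toEnd (h : IsDeformedRep 0 e x) : Q.Preproj →ₐ[ℂ] Module.End ℂ X :=
  RingQuot.liftAlgHom ℂ ⟨FreeAlgebra.lift ℂ (Sum.elim e x), by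
    intro a b hab
    have he : ∀ i, FreeAlgebra.lift ℂ (Sum.elim e x) (Q.e i) = e i := fun i => by
      simp [LooplessQuiver.e]
    have hx : ∀ a, FreeAlgebra.lift ℂ (Sum.elim e x) (Q.x a) = x a := fun i => by
      simp [LooplessQuiver.x]
    cases hab with
    | vertex_mul i j =>
      rw [map_mul, he, he, h.mul]
      split_ifs <;> simp [he]
    | vertex_sum => simp [he, h.sum]
    | arrow_left a => rw [map_mul, he, hx, h.left]
    | arrow_right a => rw [map_mul, he, hx, h.right]
    | preprojective => simpa [hx] using h.rel⟩

lemma toEnd_pe (h : IsDeformedRep 0 e x) (i : Q.V) : h.toEnd (Q.pe i) = e i := by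
  simp [toEnd, LooplessQuiver.pe, LooplessQuiver.e]

lemma toEnd_px (h : IsDeformedRep 0 e x) (a : Q.DArrow) : h.toEnd (Q.px a) = x a := by
  simp [toEnd, LooplessQuiver.px, LooplessQuiver.x]

/-- The preprojective module defined by the operators `e` and `x`. -/
noncomputable def toModule (h : IsDeformedRep 0 e x) : ModuleCat.{0} Q.Preproj :=
  letI : Module Q.Preproj X := Module.compHom X h.toEnd.toRingHom
  ModuleCat.of Q.Preproj X

/-- The underlying vector space of `toModule`. -/
noncomputable def carrierEquiv (h : IsDeformedRep 0 e x) : h.toModule ≃+ X := AddEquiv.refl X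

lemma carrierEquiv_smul (h : IsDeformedRep 0 e x) (p : Q.Preproj) (m : h.toModule) :
    h.carrierEquiv (p • m) = h.toEnd p (h.carrierEquiv m) := rfl

attribute [local instance] ModuleCat.moduleOfAlgebraModule
  ModuleCat.isScalarTower_of_algebra_moduleCat

lemma carrierEquiv_csmul (h : IsDeformedRep 0 e x) (c : ℂ) (m : h.toModule) :
    h.carrierEquiv (c • m) = c • h.carrierEquiv m := by
  rw [← algebraMap_smul Q.Preproj c m, carrierEquiv_smul, AlgHom.commutes]
  rfl

/-- The underlying vector space of `toModule`, linearly. -/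
noncomputable def carrierLinearEquiv (h : IsDeformedRep 0 e x) : h.toModule ≃ₗ[ℂ] X :=
  { h.carrierEquiv with map_smul' := h.carrierEquiv_csmul }

lemma finDim_toModule [FiniteDimensional ℂ X] (h : IsDeformedRep 0 e x) :
    Q.FinDim h.toModule :=
  Module.Finite.equiv h.carrierLinearEquiv.symm

lemma isNilpotentMod_toModule (h : IsDeformedRep 0 e x)
    (hn : ∃ N : ℕ, ∀ l : List Q.DArrow, l.length = N → (l.map x).prod = 0) :
    Q.IsNilpotentMod h.toModule := by
  obtain ⟨N, hN⟩ := hn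
  refine ⟨N, fun l hl m => h.carrierEquiv.injective ?_⟩
  have : h.toEnd (l.map Q.px).prod = (l.map x).prod := by
    rw [map_list_prod, List.map_map]
    congr 1
    exact List.map_congr_left fun a _ => h.toEnd_px a
  rw [carrierEquiv_smul, this, hN l hl]
  simp

/-- The subspace of `X` underlying a submodule of `toModule`. -/
noncomputable def subspace (h : IsDeformedRep 0 e x) (N : Submodule Q.Preproj h.toModule) :
    Submodule ℂ X :=
  (N.restrictScalars ℂ).map h.carrierLinearEquiv.toLinearMap

lemma mem_subspace (h : IsDeformedRep 0 e x) (N : Submodule Q.Preproj h.toModule) (w : X) :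
    w ∈ h.subspace N ↔ h.carrierEquiv.symm w ∈ N := by
  constructor
  · rintro ⟨m, hm, rfl⟩
    exact hm
  · intro hw
    exact ⟨_, hw, rfl⟩

lemma isSubrep_subspace (h : IsDeformedRep 0 e x) (N : Submodule Q.Preproj h.toModule) :
    IsSubrep e x (h.subspace N) := by
  constructor
  · intro i w hw
    rw [mem_subspace] at hw ⊢
    have := N.smul_mem (Q.pe i) hw
    convert this using 1
    apply h.carrierEquiv.injective
    rw [carrierEquiv_smul, toEnd_pe]
    simp
  · intro i w hw
    rw [mem_subspace] at hw ⊢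
    have := N.smul_mem (Q.px i) hw
    convert this using 1
    apply h.carrierEquiv.injective
    rw [carrierEquiv_smul, toEnd_px]
    simp

lemma subspace_injective (h : IsDeformedRep 0 e x) : Function.Injective h.subspace := by
  intro N N' hNN
  ext m
  have := congrArg (fun S => h.carrierEquiv m ∈ S) hNN
  simpa [mem_subspace] using this

lemma subspace_ne_bot (h : IsDeformedRep 0 e x) {N : Submodule Q.Preproj h.toModule}
    (hN : N ≠ ⊥) : h.subspace N ≠ ⊥ := by
  intro hb
  refine hN (h.subspace_injective (hb.trans ?_))
  ext w
  simp [mem_subspace]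

lemma subspace_ne_top (h : IsDeformedRep 0 e x) {N : Submodule Q.Preproj h.toModule}
    (hN : N ≠ ⊤) : h.subspace N ≠ ⊤ := by
  intro hb
  refine hN (h.subspace_injective (hb.trans ?_))
  ext w
  simp [mem_subspace]

lemma dimVec_of (h : IsDeformedRep 0 e x) (N : Submodule Q.Preproj h.toModule) (i : Q.V) :
    Q.dimVec (ModuleCat.of Q.Preproj N) i = Module.finrank ℂ ((h.subspace N).map (e i)) := by
  let f : ModuleCat.of Q.Preproj N →ₗ[ℂ] X :=
    { toFun := fun m => h.carrierEquiv m.1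
      map_add' := fun a b => h.carrierEquiv.map_add a.1 b.1
      map_smul' := fun c m => by
        rw [← algebraMap_smul Q.Preproj c m]
        have := h.carrierEquiv_csmul c m.1
        rw [← algebraMap_smul Q.Preproj c m.1] at this
        exact this }
  have hf : Function.Injective f := fun a b hab =>
    Subtype.ext (h.carrierEquiv.injective hab)
  have : (h.subspace N).map (e i) = (Submodule.span ℂ
      (Set.range fun m : ModuleCat.of Q.Preproj N => Q.pe i • m)).map f := by
    rw [Submodule.map_span, ← Set.range_comp]
    have : (f ∘ fun m : ModuleCat.of Q.Preproj N => Q.pe i • m) = fun m => e i (f m) := by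
      funext m
      change h.carrierEquiv (Q.pe i • m.1) = _
      rw [carrierEquiv_smul, toEnd_pe]
      rfl
    rw [this]
    have h2 : (Set.range fun m => e i (f m)) = ((h.subspace N).map (e i) : Set X) := by
      ext w
      constructor
      · rintro ⟨m, rfl⟩
        exact ⟨f m, ⟨m.1, m.2, rfl⟩, rfl⟩
      · rintro ⟨_, ⟨m, hm, rfl⟩, rfl⟩
        exact ⟨⟨m, hm⟩, rfl⟩
    rw [h2, Submodule.span_eq]
  rw [this]
  unfold dimVec dimAt
  exact_mod_cast (LinearEquiv.finrank_eq (Submodule.equivMapOfInjective f hf _))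

lemma dimVec_toModule (h : IsDeformedRep 0 e x) (i : Q.V) :
    Q.dimVec h.toModule i = Module.finrank ℂ (LinearMap.range (e i)) := by
  have : LinearMap.range (e i) = (Submodule.span ℂ
      (Set.range fun m : h.toModule => Q.pe i • m)).map h.carrierLinearEquiv.toLinearMap := by
    rw [Submodule.map_span, ← Set.range_comp]
    have h2 : Set.range (h.carrierLinearEquiv.toLinearMap ∘
        fun m : h.toModule => Q.pe i • m) = (LinearMap.range (e i) : Set X) := by
      ext w
      constructor
      · rintro ⟨m, rfl⟩
        refine ⟨h.carrierEquiv m, ?_⟩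
        rw [← toEnd_pe h]
        rfl
      · rintro ⟨m, rfl⟩
        refine ⟨h.carrierEquiv.symm m, ?_⟩
        rw [← toEnd_pe h]
        rfl
    rw [h2, Submodule.span_eq]
  rw [this]
  unfold dimVec dimAt
  exact_mod_cast (LinearEquiv.finrank_eq (Submodule.equivMapOfInjective _
    h.carrierLinearEquiv.injective _))

end IsDeformedRep

end LooplessQuiver

section LinearAlgebra

variable {W W' : Type*} [AddCommGroup W] [Module ℂ W] [AddCommGroup W'] [Module ℂ W']

lemma finrank_map_add_finrank_inf_ker [FiniteDimensional ℂ W] (f : W →ₗ[ℂ] W')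
    (S : Submodule ℂ W) :
    Module.finrank ℂ (S.map f) + Module.finrank ℂ ↥(S ⊓ LinearMap.ker f) =
      Module.finrank ℂ S := by
  have h := (f.domRestrict S).finrank_range_add_finrank_ker
  rw [LinearMap.range_domRestrict, LinearMap.ker_domRestrict] at h
  have h2 : (Submodule.comap S.subtype (LinearMap.ker f)).map S.subtype =
      S ⊓ LinearMap.ker f := Submodule.map_comap_subtype S _
  rw [← h2, (Submodule.equivMapOfInjective S.subtype S.subtype_injective _).symm.finrank_eq]
  exact h

end LinearAlgebra

/-- Multiplication by `t` on the truncated polynomials `W[t] / t ^ N`. -/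
def shift {W : Type*} [AddCommGroup W] [Module ℂ W] (N : ℕ) :
    (Fin N → W) →ₗ[ℂ] (Fin N → W) where
  toFun u k := if (k : ℕ) = 0 then 0 else u ⟨k - 1, by omega⟩
  map_add' u v := by
    funext k
    by_cases h : (k : ℕ) = 0 <;> simp [h]
  map_smul' c u := by
    funext k
    by_cases h : (k : ℕ) = 0 <;> simp [h]

section Shift

variable {W : Type*} [AddCommGroup W] [Module ℂ W] {N : ℕ}

lemma shift_apply (u : Fin N → W) (k : Fin N) :
    shift N u k = if (k : ℕ) = 0 then 0 else u ⟨k - 1, by omega⟩ := rfl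

lemma shift_eq_zero_of_lt {u : Fin N → W} {k : ℕ} (hu : ∀ j : Fin N, (j : ℕ) < k → u j = 0)
    (j : Fin N) (hj : (j : ℕ) < k + 1) : shift N u j = 0 := by
  rw [shift_apply]
  split_ifs with h
  · rfl
  · exact hu _ (by simp only; omega)

lemma shift_compLeft (f : Module.End ℂ W) (u : Fin N → W) :
    shift N (f.compLeft (Fin N) u) = f.compLeft (Fin N) (shift N u) := by
  funext k
  simp only [shift_apply, LinearMap.compLeft_apply, Function.comp]
  split_ifs <;> simp

lemma mem_range_shift (u : Fin N → W) :
    u ∈ LinearMap.range (shift (W := W) N) ↔ ∀ j : Fin N, (j : ℕ) = 0 → u j = 0 := by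
  constructor
  · rintro ⟨v, rfl⟩ j hj
    simp [shift_apply, hj]
  · intro h
    refine ⟨fun j => if hj : (j : ℕ) + 1 < N then u ⟨j + 1, hj⟩ else 0, ?_⟩
    funext k
    rw [shift_apply]
    by_cases h0 : (k : ℕ) = 0
    · rw [if_pos h0, h k h0]
    · have hk : (k : ℕ) - 1 + 1 = k := by omega
      rw [if_neg h0, dif_pos (by simp only [hk, Fin.is_lt])]
      exact congrArg u (Fin.ext hk)

lemma mem_ker_shift (u : Fin N → W) :
    u ∈ LinearMap.ker (shift (W := W) N) ↔ ∀ j : Fin N, (j : ℕ) + 1 < N → u j = 0 := by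
  rw [LinearMap.mem_ker]
  constructor
  · intro h j hj
    have := congrFun h ⟨j + 1, hj⟩
    simpa [shift_apply] using this
  · intro h
    funext k
    rw [shift_apply]
    split_ifs with h0
    · rfl
    · exact h _ (by simp only; omega)

lemma finrank_ker_shift_map (f : Module.End ℂ W) (hN : 0 < N) :
    Module.finrank ℂ ((LinearMap.ker (shift (W := W) N)).map (f.compLeft (Fin N))) =
      Module.finrank ℂ (LinearMap.range f) := by
  have hker : LinearMap.ker (shift (W := W) N) =
      LinearMap.range (LinearMap.single ℂ (fun _ : Fin N => W) ⟨N - 1, by omega⟩) := by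
    ext u
    rw [mem_ker_shift]
    constructor
    · intro h
      refine ⟨u ⟨N - 1, by omega⟩, ?_⟩
      funext k
      by_cases hk : k = ⟨N - 1, by omega⟩
      · subst hk
        simp
      · have : (k : ℕ) ≠ N - 1 := fun h => hk (Fin.ext h)
        rw [h k (by omega)]
        simp [hk]
    · rintro ⟨w, rfl⟩ j hj
      have : j ≠ ⟨N - 1, by omega⟩ := fun h => by
        have := congrArg Fin.val h
        simp only at this
        omega
      simp [this]
  have hcomp : f.compLeft (Fin N) ∘ₗ
      (LinearMap.single ℂ (fun _ : Fin N => W) ⟨N - 1, by omega⟩) =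
      (LinearMap.single ℂ (fun _ : Fin N => W) ⟨N - 1, by omega⟩) ∘ₗ f := by
    ext w k
    by_cases hk : k = ⟨N - 1, by omega⟩
    · subst hk
      simp
    · simp [hk]
  rw [hker, ← LinearMap.range_comp, hcomp, LinearMap.range_comp]
  exact (LinearEquiv.finrank_eq (Submodule.equivMapOfInjective _
    (Pi.single_injective (M := fun _ : Fin N => W) _) _)).symm

end Shift

namespace LooplessQuiver

variable {Q : LooplessQuiver}

section Lattice

variable {W : Type*} [AddCommGroup W] [Module ℂ W] (N : ℕ)

/-- The vertex idempotents on truncated polynomials. -/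
def polyE (e : Q.V → Module.End ℂ W) (i : Q.V) : Module.End ℂ (Fin N → W) :=
  (e i).compLeft (Fin N)

/-- The arrows rescaled by `t` on truncated polynomials. -/
def polyX (x : Q.DArrow → Module.End ℂ W) (a : Q.DArrow) : Module.End ℂ (Fin N → W) :=
  shift N ∘ₗ (x a).compLeft (Fin N)

/-- Truncated lattices in `W[t]`, stable under the vertex idempotents and the rescaled arrows. -/
structure IsLattice (e : Q.V → Module.End ℂ W) (x : Q.DArrow → Module.End ℂ W)
    (L : Submodule ℂ (Fin N → W)) : Prop where
  sub : IsSubrep (polyE N e) (polyX N x) L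
  shift_mem : ∀ u ∈ L, shift N u ∈ L
  ker_le : LinearMap.ker (shift (W := W) N) ≤ L

variable {N} {e : Q.V → Module.End ℂ W} {x : Q.DArrow → Module.End ℂ W} {lam : Q.V → ℂ}

lemma polyE_mul (h : IsDeformedRep lam e x) (i j : Q.V) :
    polyE N e i * polyE N e j = if i = j then polyE N e i else 0 := by
  refine LinearMap.ext fun u => funext fun k => ?_
  have := LinearMap.congr_fun (h.mul i j) (u k)
  rw [Module.End.mul_apply] at this ⊢
  change e i (e j (u k)) = _
  rw [this]
  split_ifs <;> rfl

lemma polyE_idem (h : IsDeformedRep lam e x) (i : Q.V) (u : Fin N → W) :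
    polyE N e i (polyE N e i u) = polyE N e i u := by
  have := LinearMap.congr_fun (polyE_mul (N := N) h i i) u
  simpa using this

lemma polyE_shift (i : Q.V) (u : Fin N → W) :
    polyE N e i (shift N u) = shift N (polyE N e i u) :=
  (shift_compLeft _ _).symm

lemma polyX_shift (a : Q.DArrow) (u : Fin N → W) :
    polyX N x a (shift N u) = shift N (polyX N x a u) := by
  simp only [polyX, LinearMap.comp_apply, shift_compLeft]

/-- The relations of the rescaled action. -/
lemma polyX_rel (h : IsDeformedRep lam e x) (u : Fin N → W) :
    (∑ a : Q.A, (polyX N x (Sum.inl a) * polyX N x (Sum.inr a) -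
      polyX N x (Sum.inr a) * polyX N x (Sum.inl a))) u =
      shift N (shift N (∑ i, lam i • polyE N e i u)) := by
  have h1 : ∀ a b : Q.DArrow, ∀ u, (polyX N x a * polyX N x b) u =
      shift N (shift N ((x a * x b).compLeft (Fin N) u)) := by
    intro a b u
    rw [Module.End.mul_apply]
    simp only [polyX, LinearMap.comp_apply, ← shift_compLeft]
    rfl
  simp only [LinearMap.sum_apply, LinearMap.sub_apply, h1, ← map_sub, ← map_sum]
  congr 2
  funext k
  have := LinearMap.congr_fun h.rel (u k)
  simpa [LinearMap.sum_apply, polyE] using this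

lemma polyX_prod_eq_zero (l : List Q.DArrow) (u : Fin N → W) (j : Fin N)
    (hj : (j : ℕ) < l.length) : (l.map (polyX N x)).prod u j = 0 := by
  induction l generalizing j with
  | nil => simp at hj
  | cons a l ih =>
    rw [List.map_cons, List.prod_cons, Module.End.mul_apply]
    refine shift_eq_zero_of_lt (k := l.length) (fun j hj => ?_) j (by simpa using hj)
    rw [LinearMap.compLeft_apply, Function.comp, ih j hj, map_zero]

lemma IsLattice.finrank_map [FiniteDimensional ℂ W] (h : IsDeformedRep lam e x) (hN : 0 < N)
    {L : Submodule ℂ (Fin N → W)} (hL : IsLattice N e x L) (i : Q.V) :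
    Module.finrank ℂ (L.map (polyE N e i)) =
      Module.finrank ℂ ((L.map (shift N)).map (polyE N e i)) +
        Module.finrank ℂ (LinearMap.range (e i)) := by
  have h1 : (L.map (polyE N e i)).map (shift N) = (L.map (shift N)).map (polyE N e i) := by
    ext u
    constructor
    · rintro ⟨_, ⟨v, hv, rfl⟩, rfl⟩
      exact ⟨_, ⟨v, hv, rfl⟩, polyE_shift i v⟩
    · rintro ⟨_, ⟨v, hv, rfl⟩, rfl⟩
      exact ⟨_, ⟨v, hv, rfl⟩, (polyE_shift i v).symm⟩
  have h2 : L.map (polyE N e i) ⊓ LinearMap.ker (shift N) =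
      (LinearMap.ker (shift N)).map ((e i).compLeft (Fin N)) := by
    ext u
    constructor
    · rintro ⟨⟨v, hv, rfl⟩, hk⟩
      exact ⟨_, hk, polyE_idem h i v⟩
    · rintro ⟨v, hv, rfl⟩
      refine ⟨⟨v, hL.ker_le hv, rfl⟩, ?_⟩
      have hv : shift N v = 0 := hv
      change shift N (polyE N e i v) = 0
      rw [← polyE_shift, hv, map_zero]
  rw [← finrank_map_add_finrank_inf_ker (shift N) (L.map (polyE N e i)),
    ← finrank_ker_shift_map (e i) hN, h1, h2]

/-- Leading coefficients of order `k` of the elements of `L`. -/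
def leading (L : Submodule ℂ (Fin N → W)) (k : ℕ) : Submodule ℂ W where
  carrier := {w | ∃ u ∈ L, (∀ j : Fin N, (j : ℕ) < k → u j = 0) ∧
    ∀ j : Fin N, (j : ℕ) = k → u j = w}
  add_mem' := by
    rintro w w' ⟨u, hu, h1, h2⟩ ⟨u', hu', h1', h2'⟩
    exact ⟨u + u', L.add_mem hu hu', fun j hj => by simp [h1 j hj, h1' j hj],
      fun j hj => by simp [h2 j hj, h2' j hj]⟩
  zero_mem' := ⟨0, L.zero_mem, by simp, by simp⟩
  smul_mem' := by
    rintro c w ⟨u, hu, h1, h2⟩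
    exact ⟨c • u, L.smul_mem c hu, fun j hj => by simp [h1 j hj],
      fun j hj => by simp [h2 j hj]⟩

lemma leading_mono {L : Submodule ℂ (Fin N → W)} (hL : IsLattice N e x L) (k : ℕ) :
    leading L k ≤ leading L (k + 1) := by
  rintro w ⟨u, hu, h1, h2⟩
  refine ⟨shift N u, hL.shift_mem u hu, shift_eq_zero_of_lt h1, fun j hj => ?_⟩
  rw [shift_apply, if_neg (by omega)]
  exact h2 _ (by simp only; omega)

lemma leading_x {L : Submodule ℂ (Fin N → W)} (hL : IsLattice N e x L) (k : ℕ)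
    (a : Q.DArrow) {w : W} (hw : w ∈ leading L k) : x a w ∈ leading L (k + 1) := by
  obtain ⟨u, hu, h1, h2⟩ := hw
  refine ⟨polyX N x a u, hL.sub.2 a u hu, shift_eq_zero_of_lt fun j hj => ?_, fun j hj => ?_⟩
  · simp [h1 j hj]
  · rw [polyX, LinearMap.comp_apply, shift_apply, if_neg (by omega), LinearMap.compLeft_apply,
      Function.comp, h2 _ (by simp only; omega)]

lemma leading_e {L : Submodule ℂ (Fin N → W)} (hL : IsLattice N e x L) (k : ℕ)
    (i : Q.V) {w : W} (hw : w ∈ leading L k) : e i w ∈ leading L k := by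
  obtain ⟨u, hu, h1, h2⟩ := hw
  exact ⟨polyE N e i u, hL.sub.1 i u hu, fun j hj => by simp [polyE, h1 j hj],
    fun j hj => by simp [polyE, h2 j hj]⟩

/-- If `W` is simple, a lattice not contained in `t W[t]` contains `t ^ dim W W[t]`. -/
lemma IsLattice.mem_of_vanish [FiniteDimensional ℂ W]
    (simple : ∀ S, IsSubrep e x S → S = ⊥ ∨ S = ⊤)
    {L : Submodule ℂ (Fin N → W)} (hL : IsLattice N e x L)
    (hnot : ¬ L ≤ LinearMap.range (shift (W := W) N))
    (u : Fin N → W) (hu : ∀ j : Fin N, (j : ℕ) < Module.finrank ℂ W → u j = 0) : u ∈ L := by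
  have hmono : Monotone (leading L) := monotone_nat_of_le_succ (leading_mono hL)
  have h0 : leading L 0 ≠ ⊥ := by
    intro hb
    refine hnot fun u hu => ?_
    rw [mem_range_shift]
    intro j hj
    have : u j ∈ leading L 0 :=
      ⟨u, hu, by simp, fun j' hj' => by rw [Fin.ext (hj'.trans hj.symm)]⟩
    rwa [hb, Submodule.mem_bot] at this
  have hgrow : ∀ k, leading L k = ⊤ ∨ k + 1 ≤ Module.finrank ℂ (leading L k) := by
    intro k
    induction k with
    | zero => exact Or.inr ((Submodule.one_le_finrank_iff).2 h0)
    | succ k ih =>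
      rcases ih with ih | ih
      · exact Or.inl (top_le_iff.1 (ih ▸ hmono k.le_succ))
      · rcases (hmono k.le_succ).eq_or_lt with heq | hlt
        · left
          have hs : IsSubrep e x (leading L k) :=
            ⟨fun i w hw => leading_e hL k i hw, fun a w hw => by
              rw [heq]
              exact leading_x hL k a hw⟩
          rcases simple _ hs with hb | ht
          · exact absurd (le_bot_iff.1 (hb ▸ hmono k.zero_le)) h0
          · exact heq.symm.trans ht
        · exact Or.inr (ih.trans_lt (Submodule.finrank_lt_finrank_of_lt hlt))
  have htop : ∀ k, Module.finrank ℂ W ≤ k → leading L k = ⊤ := by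
    intro k hk
    rcases hgrow (Module.finrank ℂ W) with h | h
    · exact top_le_iff.1 (h ▸ hmono hk)
    · exact absurd (Submodule.finrank_le (leading L (Module.finrank ℂ W))) (by omega)
  have main : ∀ d k, k + d = N → Module.finrank ℂ W ≤ k →
      ∀ u : Fin N → W, (∀ j : Fin N, (j : ℕ) < k → u j = 0) → u ∈ L := by
    intro d
    induction d with
    | zero =>
      intro k hk _ u hu
      have : u = 0 := funext fun j => hu j (by omega)
      rw [this]
      exact L.zero_mem
    | succ d ih =>
      intro k hk hn u hu
      have hw : u ⟨k, by omega⟩ ∈ leading L k := by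
        rw [htop k hn]
        trivial
      obtain ⟨v, hv, h1, h2⟩ := hw
      have := ih (k + 1) (by omega) (by omega) (u - v) fun j hj => by
        rcases Nat.lt_succ_iff_lt_or_eq.1 hj with hj | hj
        · simp [hu j hj, h1 j hj]
        · have : j = ⟨k, by omega⟩ := Fin.ext hj
          rw [Pi.sub_apply, h2 j hj, this, sub_self]
      simpa using L.add_mem this hv
  rcases le_total (Module.finrank ℂ W) N with h | h
  · exact main (N - Module.finrank ℂ W) _ (by omega) le_rfl u hu
  · have : u = 0 := funext fun j => hu j (by omega)
    rw [this]
    exact L.zero_mem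

end Lattice

end LooplessQuiver

namespace LooplessQuiver

variable {Q : LooplessQuiver}

section Subquotient

variable {U : Type*} [AddCommGroup U] [Module ℂ U] (L K : Submodule ℂ U)

/-- The operator induced on the subquotient `L / K`. -/
noncomputable def subquot (f : Module.End ℂ U) (hL : ∀ u ∈ L, f u ∈ L) (hK : ∀ u ∈ K, f u ∈ K) :
    Module.End ℂ (L ⧸ K.comap L.subtype) :=
  Submodule.mapQ _ _ (f.restrict hL) fun u hu => hK u hu

variable {L K}

lemma subquot_mk (f : Module.End ℂ U) (hL : ∀ u ∈ L, f u ∈ L) (hK : ∀ u ∈ K, f u ∈ K) (u : L) :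
    subquot L K f hL hK (Submodule.Quotient.mk u) = Submodule.Quotient.mk ⟨f u, hL u u.2⟩ := rfl

lemma subquot_eq_of_forall {f g : Module.End ℂ (L ⧸ K.comap L.subtype)}
    (h : ∀ u : L, f (Submodule.Quotient.mk u) = g (Submodule.Quotient.mk u)) : f = g := by
  refine LinearMap.ext fun u => ?_
  obtain ⟨u, rfl⟩ := Submodule.Quotient.mk_surjective _ u
  exact h u

/-- The inverse image in `L` of a subspace of `L / K`. -/
def subquotComap (S : Submodule ℂ (L ⧸ K.comap L.subtype)) : Submodule ℂ U :=
  (S.comap (K.comap L.subtype).mkQ).map L.subtype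

lemma mem_subquotComap (S : Submodule ℂ (L ⧸ K.comap L.subtype)) (u : U) :
    u ∈ subquotComap S ↔ ∃ h : u ∈ L, Submodule.Quotient.mk ⟨u, h⟩ ∈ S := by
  constructor
  · rintro ⟨v, hv, rfl⟩
    exact ⟨v.2, hv⟩
  · rintro ⟨h, hu⟩
    exact ⟨⟨u, h⟩, hu, rfl⟩

lemma subquotComap_le (S : Submodule ℂ (L ⧸ K.comap L.subtype)) : subquotComap S ≤ L :=
  fun u hu => ((mem_subquotComap S u).1 hu).1

lemma le_subquotComap (hKL : K ≤ L) (S : Submodule ℂ (L ⧸ K.comap L.subtype)) :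
    K ≤ subquotComap S := by
  intro u hu
  refine (mem_subquotComap S u).2 ⟨hKL hu, ?_⟩
  rw [(Submodule.Quotient.mk_eq_zero _).2 (show (⟨u, hKL hu⟩ : L) ∈ K.comap L.subtype from hu)]
  exact S.zero_mem

lemma subquotComap_top : subquotComap (⊤ : Submodule ℂ (L ⧸ K.comap L.subtype)) = L := by
  ext u
  simp [mem_subquotComap]

lemma finrank_subquot_map [FiniteDimensional ℂ U] (hKL : K ≤ L)
    (f : Module.End ℂ U) (hL : ∀ u ∈ L, f u ∈ L) (hK : ∀ u ∈ K, f u ∈ K)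
    (hf : ∀ u, f (f u) = f u) (S : Submodule ℂ (L ⧸ K.comap L.subtype)) :
    Module.finrank ℂ (S.map (subquot L K f hL hK)) + Module.finrank ℂ (K.map f) =
      Module.finrank ℂ ((subquotComap S).map f) := by
  let A : Submodule ℂ L := (S.comap (K.comap L.subtype).mkQ).map (f.restrict hL)
  have h1 : A.map (K.comap L.subtype).mkQ = S.map (subquot L K f hL hK) := by
    ext y
    constructor
    · rintro ⟨_, ⟨v, hv, rfl⟩, rfl⟩
      exact ⟨_, hv, rfl⟩
    · rintro ⟨y, hy, rfl⟩
      obtain ⟨v, rfl⟩ := Submodule.Quotient.mk_surjective _ y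
      exact ⟨_, ⟨v, hy, rfl⟩, rfl⟩
  have h2 : (A ⊓ LinearMap.ker (K.comap L.subtype).mkQ).map L.subtype = K.map f := by
    ext y
    constructor
    · rintro ⟨_, ⟨⟨v, hv, rfl⟩, hk⟩, rfl⟩
      rw [Submodule.ker_mkQ] at hk
      exact ⟨_, hk, hf v⟩
    · rintro ⟨y, hy, rfl⟩
      refine ⟨⟨f y, hL y (hKL hy)⟩, ⟨⟨⟨y, hKL hy⟩, ?_, rfl⟩, ?_⟩, rfl⟩
      · obtain ⟨_, h⟩ := (mem_subquotComap S y).1 (le_subquotComap hKL S hy)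
        exact h
      · rw [Submodule.ker_mkQ]
        exact hK y hy
  have h3 : A.map L.subtype = (subquotComap S).map f := by
    ext y
    constructor
    · rintro ⟨_, ⟨v, hv, rfl⟩, rfl⟩
      exact ⟨v, ⟨v, hv, rfl⟩, rfl⟩
    · rintro ⟨_, ⟨v, hv, rfl⟩, rfl⟩
      exact ⟨_, ⟨v, hv, rfl⟩, rfl⟩
  have h4 := finrank_map_add_finrank_inf_ker (Submodule.mkQ (K.comap L.subtype)) A
  rw [h1] at h4
  rw [← h2, ← h3,
    ← (Submodule.equivMapOfInjective L.subtype L.subtype_injective A).finrank_eq, ← h4,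
    ← (Submodule.equivMapOfInjective L.subtype L.subtype_injective
      (A ⊓ LinearMap.ker (K.comap L.subtype).mkQ)).finrank_eq]

end Subquotient

lemma IsLattice.map_shift {W : Type*} [AddCommGroup W] [Module ℂ W] {N : ℕ}
    {e : Q.V → Module.End ℂ W} {x : Q.DArrow → Module.End ℂ W} {L : Submodule ℂ (Fin N → W)}
    (hL : IsLattice N e x L) : IsSubrep (polyE N e) (polyX N x) (L.map (shift N)) := by
  constructor
  · rintro i _ ⟨u, hu, rfl⟩
    exact ⟨_, hL.sub.1 i u hu, (polyE_shift i u).symm⟩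
  · rintro i _ ⟨u, hu, rfl⟩
    exact ⟨_, hL.sub.2 i u hu, (polyX_shift i u).symm⟩

lemma IsLattice.map_shift_le {W : Type*} [AddCommGroup W] [Module ℂ W] {N : ℕ}
    {e : Q.V → Module.End ℂ W} {x : Q.DArrow → Module.End ℂ W} {L : Submodule ℂ (Fin N → W)}
    (hL : IsLattice N e x L) : L.map (shift N) ≤ L := by
  rintro _ ⟨u, hu, rfl⟩
  exact hL.shift_mem u hu

section Reduction

variable {W : Type*} [AddCommGroup W] [Module ℂ W] {N : ℕ}
  {e : Q.V → Module.End ℂ W} {x : Q.DArrow → Module.End ℂ W} {lam : Q.V → ℂ}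
  {L : Submodule ℂ (Fin N → W)}

/-- The vertex idempotents on `L / t L`. -/
noncomputable def redE (hL : IsLattice N e x L) (i : Q.V) :
    Module.End ℂ (L ⧸ (L.map (shift N)).comap L.subtype) :=
  subquot L (L.map (shift N)) (polyE N e i) (hL.sub.1 i) (hL.map_shift.1 i)

/-- The rescaled arrows on `L / t L`. -/
noncomputable def redX (hL : IsLattice N e x L) (a : Q.DArrow) :
    Module.End ℂ (L ⧸ (L.map (shift N)).comap L.subtype) :=
  subquot L (L.map (shift N)) (polyX N x a) (hL.sub.2 a) (hL.map_shift.2 a)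

lemma isDeformedRep_red (h : IsDeformedRep lam e x) (hL : IsLattice N e x L) :
    IsDeformedRep 0 (redE hL) (redX hL) where
  mul i j := by
    refine subquot_eq_of_forall fun u => ?_
    have := LinearMap.congr_fun (polyE_mul (N := N) h i j) u
    rw [Module.End.mul_apply] at this ⊢
    simp only [redE, subquot_mk, this]
    split_ifs with hij
    · rw [subquot_mk]
    · rfl
  sum := by
    refine subquot_eq_of_forall fun u => ?_
    rw [LinearMap.sum_apply]
    simp only [redE, subquot_mk]
    simp only [← Submodule.mkQ_apply]
    rw [← map_sum, Module.End.one_apply]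
    congr 1
    refine Subtype.ext (funext fun k => ?_)
    have := LinearMap.congr_fun h.sum (u.1 k)
    simpa [polyE] using this
  left a := by
    refine subquot_eq_of_forall fun u => ?_
    rw [Module.End.mul_apply]
    simp only [redE, redX, subquot_mk]
    congr 2
    simp only [polyX, LinearMap.comp_apply, polyE_shift]
    congr 1
    funext k
    exact LinearMap.congr_fun (h.left a) (u.1 k)
  right a := by
    refine subquot_eq_of_forall fun u => ?_
    rw [Module.End.mul_apply]
    simp only [redE, redX, subquot_mk]
    congr 2
    simp only [polyX, LinearMap.comp_apply]
    congr 1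
    funext k
    exact LinearMap.congr_fun (h.right a) (u.1 k)
  rel := by
    refine subquot_eq_of_forall fun u => ?_
    have h1 := polyX_rel h u.1
    simp only [Pi.zero_apply, zero_smul, Finset.sum_const_zero, LinearMap.zero_apply]
    simp only [LinearMap.sum_apply, LinearMap.sub_apply, Module.End.mul_apply, redX,
      subquot_mk] at h1 ⊢
    simp only [← Submodule.mkQ_apply]
    simp only [← map_sub, ← map_sum]
    rw [Submodule.mkQ_apply, Submodule.Quotient.mk_eq_zero]
    change L.subtype _ ∈ L.map (shift N)
    simp only [map_sum, map_sub, Submodule.subtype_apply]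
    rw [h1]
    exact ⟨_, hL.shift_mem _ (L.sum_mem fun i _ => L.smul_mem _ (hL.sub.1 i _ u.2)), rfl⟩

lemma redX_prod_eq_zero (hL : IsLattice N e x L) (l : List Q.DArrow) (hl : l.length = N) :
    (l.map (redX hL)).prod = 0 := by
  have key : ∀ l : List Q.DArrow, ∀ u : L, ∃ h : (l.map (polyX N x)).prod u.1 ∈ L,
      (l.map (redX hL)).prod (Submodule.Quotient.mk u) = Submodule.Quotient.mk ⟨_, h⟩ := by
    intro l
    induction l with
    | nil => exact fun u => ⟨u.2, rfl⟩
    | cons a l ih =>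
      intro u
      obtain ⟨h, hu⟩ := ih u
      refine ⟨hL.sub.2 a _ h, ?_⟩
      rw [List.map_cons, List.prod_cons, Module.End.mul_apply, hu]
      rfl
  refine subquot_eq_of_forall fun u => ?_
  obtain ⟨h, hu⟩ := key l u
  rw [hu, LinearMap.zero_apply, Submodule.Quotient.mk_eq_zero]
  have : (l.map (polyX N x)).prod u.1 = 0 := by
    funext j
    exact polyX_prod_eq_zero l u.1 j (by omega)
  change (l.map (polyX N x)).prod u.1 ∈ L.map (shift N)
  rw [this]
  exact Submodule.zero_mem _

lemma isSubrep_subquotComap (hL : IsLattice N e x L)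
    {S : Submodule ℂ (L ⧸ (L.map (shift N)).comap L.subtype)}
    (hS : IsSubrep (redE hL) (redX hL) S) :
    IsSubrep (polyE N e) (polyX N x) (subquotComap S) := by
  constructor
  · intro i u hu
    obtain ⟨h, hu⟩ := (mem_subquotComap S u).1 hu
    exact (mem_subquotComap S _).2 ⟨_, hS.1 i _ hu⟩
  · intro i u hu
    obtain ⟨h, hu⟩ := (mem_subquotComap S u).1 hu
    exact (mem_subquotComap S _).2 ⟨_, hS.2 i _ hu⟩

/-- The total `θ`-weight of a lattice. -/
noncomputable def weight (e : Q.V → Module.End ℂ W) (θ : Q.V → ℝ)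
    (L : Submodule ℂ (Fin N → W)) : ℝ :=
  ∑ i, θ i * Module.finrank ℂ (L.map (polyE N e i))

/-- Some lattice maximizes the weight and is not divisible by `t`. -/
lemma exists_maximal_lattice [FiniteDimensional ℂ W] [Nontrivial W] (h : IsDeformedRep lam e x)
    (hN : 0 < N) (θ : Q.V → ℝ)
    (hθ : ∑ i, θ i * Module.finrank ℂ (LinearMap.range (e i)) = 0) :
    ∃ L : Submodule ℂ (Fin N → W), IsLattice N e x L ∧
      ¬ L ≤ LinearMap.range (shift (W := W) N) ∧
      ∀ L', IsLattice N e x L' → weight e θ L' ≤ weight e θ L := by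
  let d : Submodule ℂ (Fin N → W) → Q.V → ℕ := fun L i => Module.finrank ℂ (L.map (polyE N e i))
  let s : Set (Q.V → ℕ) := d '' {L | IsLattice N e x L}
  have hs : s.Finite := by
    refine Set.Finite.subset (Set.Finite.pi' (t := fun _ : Q.V =>
      Set.Iic (Module.finrank ℂ (Fin N → W))) fun _ => Set.finite_Iic _) ?_
    rintro _ ⟨L, _, rfl⟩ i
    exact Submodule.finrank_le _
  have hne : s.Nonempty :=
    ⟨_, ⊤, ⟨⟨fun _ _ _ => trivial, fun _ _ _ => trivial⟩, fun _ _ => trivial, le_top⟩, rfl⟩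
  obtain ⟨_, ⟨L, hL, rfl⟩, hmax⟩ := Set.exists_max_image s
    (fun d => toLex (∑ i, θ i * (d i : ℝ), ∑ i, d i)) hs hne
  have hmax' : ∀ L', IsLattice N e x L' → weight e θ L' < weight e θ L ∨
      (weight e θ L' = weight e θ L ∧ ∑ i, d L' i ≤ ∑ i, d L i) := by
    intro L' hL'
    have := hmax _ ⟨L', hL', rfl⟩
    rw [Prod.Lex.le_iff] at this
    exact this
  refine ⟨L, hL, fun hle => ?_, fun L' hL' => ?_⟩
  · have hL1 : IsLattice N e x (L.comap (shift N)) := by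
      refine ⟨⟨fun i u hu => ?_, fun a u hu => ?_⟩, fun u hu => ?_, fun u hu => ?_⟩
      · rw [Submodule.mem_comap, ← polyE_shift]
        exact hL.sub.1 i _ hu
      · rw [Submodule.mem_comap, ← polyX_shift]
        exact hL.sub.2 a _ hu
      · exact hL.shift_mem _ hu
      · rw [Submodule.mem_comap, LinearMap.mem_ker.1 hu]
        exact L.zero_mem
    have hmap : (L.comap (shift N)).map (shift N) = L := Submodule.map_comap_eq_of_le hle
    have hd : ∀ i, d (L.comap (shift N)) i = d L i + Module.finrank ℂ (LinearMap.range (e i)) := by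
      intro i
      have := hL1.finrank_map h hN i
      rwa [hmap] at this
    have hw : weight e θ (L.comap (shift N)) = weight e θ L := by
      have : weight e θ (L.comap (shift N)) = weight e θ L +
          ∑ i, θ i * Module.finrank ℂ (LinearMap.range (e i)) := by
        rw [weight, weight, ← Finset.sum_add_distrib]
        refine Finset.sum_congr rfl fun i _ => ?_
        have := hd i
        simp only [d] at this
        rw [this]
        push_cast
        ring
      rw [this, hθ, add_zero]
    rcases hmax' _ hL1 with hlt | ⟨_, hle2⟩
    · exact absurd hw hlt.ne
    · have hzero : ∀ i, e i = 0 := by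
        intro i
        simp only [hd, Finset.sum_add_distrib] at hle2
        have : ∑ i, Module.finrank ℂ (LinearMap.range (e i)) = 0 := by omega
        have := (Finset.sum_eq_zero_iff.1 this) i (Finset.mem_univ i)
        exact LinearMap.range_eq_bot.1 (Submodule.finrank_eq_zero.1 this)
      have := h.sum
      simp only [hzero, Finset.sum_const_zero] at this
      exact zero_ne_one this
  · rcases hmax' L' hL' with hlt | ⟨heq, _⟩
    · exact hlt.le
    · exact heq.le

end Reduction

/-- A simple module over a deformed preprojective algebra degenerates to a nilpotent
`θ`-semistable module over the preprojective algebra. -/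
theorem exists_semistable {W : Type} [AddCommGroup W] [Module ℂ W] [FiniteDimensional ℂ W]
    [Nontrivial W] {e : Q.V → Module.End ℂ W} {x : Q.DArrow → Module.End ℂ W} {lam : Q.V → ℂ}
    (h : IsDeformedRep lam e x) (simple : ∀ S, IsSubrep e x S → S = ⊥ ∨ S = ⊤)
    (θ : Q.V → ℝ) (hθ : ∑ i, θ i * Module.finrank ℂ (LinearMap.range (e i)) = 0) :
    ∃ (X : Type) (_ : AddCommGroup X) (_ : Module ℂ X) (_ : FiniteDimensional ℂ X)
      (e' : Q.V → Module.End ℂ X) (x' : Q.DArrow → Module.End ℂ X),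
      IsDeformedRep 0 e' x' ∧
      (∃ N : ℕ, ∀ l : List Q.DArrow, l.length = N → (l.map x').prod = 0) ∧
      (∀ i, Module.finrank ℂ (LinearMap.range (e' i)) =
        Module.finrank ℂ (LinearMap.range (e i))) ∧
      ∀ S, IsSubrep e' x' S → ∑ i, θ i * Module.finrank ℂ (S.map (e' i)) ≤ 0 := by
  let N := Module.finrank ℂ W + 2
  have hN : 0 < N := by omega
  obtain ⟨L, hL, hnot, hmax⟩ := exists_maximal_lattice (N := N) h hN θ hθ
  have hdim : ∀ (i : Q.V) (S : Submodule ℂ (L ⧸ (L.map (shift N)).comap L.subtype)),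
      Module.finrank ℂ (S.map (redE hL i)) + Module.finrank ℂ (L.map (polyE N e i)) =
        Module.finrank ℂ ((subquotComap S).map (polyE N e i)) +
          Module.finrank ℂ (LinearMap.range (e i)) := by
    intro i S
    have h1 := finrank_subquot_map hL.map_shift_le (polyE N e i) (hL.sub.1 i)
      (hL.map_shift.1 i) (polyE_idem h i) S
    have h2 := hL.finrank_map h hN i
    rw [redE]
    omega
  refine ⟨_, inferInstance, inferInstance, inferInstance, redE hL, redX hL,
    isDeformedRep_red h hL, ⟨N, redX_prod_eq_zero hL⟩, fun i => ?_, fun S hS => ?_⟩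
  · have := hdim i ⊤
    rw [subquotComap_top, Submodule.map_top] at this
    omega
  · have hlat : IsLattice N e x (subquotComap S) := by
      have hle := le_subquotComap hL.map_shift_le S
      refine ⟨isSubrep_subquotComap hL hS, fun u hu => ?_, fun u hu => ?_⟩
      · exact hle ⟨u, subquotComap_le S hu, rfl⟩
      · rw [mem_ker_shift] at hu
        have hr : u ∈ LinearMap.range (shift (W := W) N) := by
          rw [mem_range_shift]
          exact fun j hj => hu j (by omega)
        obtain ⟨v, rfl⟩ := hr
        let v' : Fin N → W := fun j => if (j : ℕ) + 1 < N then v j else 0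
        have hv' : shift N v' = shift N v := by
          funext k
          rw [shift_apply, shift_apply]
          split_ifs with h0
          · rfl
          · have : (k : ℕ) - 1 + 1 < N := by omega
            simp [v', this]
        rw [← hv']
        refine hle ⟨v', hL.mem_of_vanish simple hnot v' fun j hj => ?_, rfl⟩
        have hj1 : (j : ℕ) + 1 < N := by omega
        have := hu ⟨j + 1, hj1⟩ (by simp only; omega)
        rw [shift_apply, if_neg (by simp)] at this
        simpa [v', hj1] using this
    have hw := hmax _ hlat
    have : ∑ i, θ i * Module.finrank ℂ (S.map (redE hL i)) + weight e θ L =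
        weight e θ (subquotComap S) +
          ∑ i, θ i * Module.finrank ℂ (LinearMap.range (e i)) := by
      rw [weight, weight, ← Finset.sum_add_distrib, ← Finset.sum_add_distrib]
      refine Finset.sum_congr rfl fun i _ => ?_
      rw [← mul_add, ← mul_add]
      congr 1
      exact_mod_cast hdim i S
    linarith

end LooplessQuiver

namespace LooplessQuiver

variable {Q : LooplessQuiver}

/-- A weight orthogonal to `α` and to no other integral vector up to proportionality. -/
def IsGenericWeight (lam : Q.V → ℂ) (α : Q.V → ℤ) : Prop :=
  ∑ i, lam i * α i = 0 ∧
    ∀ β : Q.V → ℤ, ∑ i, lam i * β i = 0 → ∃ p q : ℤ, q ≠ 0 ∧ q • β = p • α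

lemma exists_isGenericWeight (α : Q.V → ℤ) : ∃ lam : Q.V → ℂ, IsGenericWeight lam α := by
  let cast : (Q.V → ℤ) → Q.V → ℚ := fun β i => β i
  let K : Submodule ℚ (Q.V → ℚ) := Submodule.span ℚ {cast α}
  have hrank : Module.rank ℚ ((Q.V → ℚ) ⧸ K) ≤ Module.rank ℚ ℂ := by
    rw [Complex.rank_rat_complex]
    exact (Module.rank_lt_aleph0 ℚ _).le.trans Cardinal.aleph0_le_continuum
  obtain ⟨f, hf⟩ := rank_le_iff_exists_linearMap.1 hrank
  have hsum : ∀ β : Q.V → ℤ, ∑ i, f (K.mkQ (Pi.single i 1)) * β i = f (K.mkQ (cast β)) := by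
    intro β
    have h1 : cast β = ∑ i, (β i : ℚ) • (Pi.single i 1 : Q.V → ℚ) := by
      rw [← pi_eq_sum_univ' (cast β)]
    rw [h1, map_sum, map_sum]
    refine Finset.sum_congr rfl fun i _ => ?_
    rw [map_smul, map_smul, Rat.smul_def, mul_comm, Rat.cast_intCast]
  refine ⟨fun i => f (K.mkQ (Pi.single i 1)), ?_, fun β hβ => ?_⟩
  · rw [hsum, Submodule.mkQ_apply,
      (Submodule.Quotient.mk_eq_zero K).2 (Submodule.mem_span_singleton_self _), map_zero]
  · rw [hsum, map_eq_zero_iff f hf, Submodule.mkQ_apply, Submodule.Quotient.mk_eq_zero,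
      Submodule.mem_span_singleton] at hβ
    obtain ⟨c, hc⟩ := hβ
    refine ⟨c.num, c.den, by exact_mod_cast c.den_ne_zero, funext fun i => ?_⟩
    have h1 : c * α i = β i := congrFun hc i
    have h2 : (c.den : ℚ) * β i = c.num * α i := by
      rw [← h1, ← mul_assoc, mul_comm (c.den : ℚ), Rat.mul_den_eq_num]
    simp only [Pi.smul_apply, smul_eq_mul]
    exact_mod_cast h2

/-- The vector `α` is the dimension vector of a deformed representation of generic weight. -/
def HasGenericRep (α : Q.V → ℤ) : Prop :=
  ∃ lam : Q.V → ℂ, IsGenericWeight lam α ∧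
    ∃ (W : Type) (_ : AddCommGroup W) (_ : Module ℂ W) (_ : FiniteDimensional ℂ W)
      (e : Q.V → Module.End ℂ W) (x : Q.DArrow → Module.End ℂ W),
      IsDeformedRep lam e x ∧ ∀ i, (Module.finrank ℂ (LinearMap.range (e i)) : ℤ) = α i

section Trace

variable {W : Type*} [AddCommGroup W] [Module ℂ W] {lam : Q.V → ℂ}
  {e : Q.V → Module.End ℂ W} {x : Q.DArrow → Module.End ℂ W}

lemma trace_eq_finrank_range [FiniteDimensional ℂ W] {p : Module.End ℂ W} (hp : p * p = p) :
    LinearMap.trace ℂ W p = Module.finrank ℂ (LinearMap.range p) := by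
  have : LinearMap.IsProj (LinearMap.range p) p := by
    refine ⟨fun w => ⟨w, rfl⟩, ?_⟩
    rintro _ ⟨w, rfl⟩
    exact LinearMap.congr_fun hp w
  exact this.trace

lemma IsDeformedRep.idem (h : IsDeformedRep lam e x) (i : Q.V) : e i * e i = e i := by
  simpa using h.mul i i

lemma IsDeformedRep.sum_weight [FiniteDimensional ℂ W] (h : IsDeformedRep lam e x) :
    ∑ i, lam i * Module.finrank ℂ (LinearMap.range (e i)) = 0 := by
  have := congrArg (LinearMap.trace ℂ W) h.rel
  simp only [map_sum, map_sub, map_smul, smul_eq_mul] at this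
  simp only [trace_eq_finrank_range (h.idem _)] at this
  rw [← this]
  exact Finset.sum_eq_zero fun a _ => sub_eq_zero.2 (LinearMap.trace_mul_comm ℂ _ _)

lemma IsDeformedRep.sum_finrank [FiniteDimensional ℂ W] (h : IsDeformedRep lam e x) :
    ∑ i, Module.finrank ℂ (LinearMap.range (e i)) = Module.finrank ℂ W := by
  have := congrArg (LinearMap.trace ℂ W) h.sum
  simp only [map_sum, LinearMap.trace_one] at this
  simp only [trace_eq_finrank_range (h.idem _)] at this
  exact_mod_cast this

lemma IsDeformedRep.restrict (h : IsDeformedRep lam e x) {S : Submodule ℂ W}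
    (hS : IsSubrep e x S) :
    IsDeformedRep lam (fun i => (e i).restrict (hS.1 i)) (fun a => (x a).restrict (hS.2 a)) where
  mul i j := by
    refine LinearMap.ext fun w => Subtype.ext ?_
    have := LinearMap.congr_fun (h.mul i j) w.1
    split_ifs with hij
    · rw [if_pos hij] at this
      exact this
    · rw [if_neg hij] at this
      exact this
  sum := by
    refine LinearMap.ext fun w => Subtype.ext ?_
    have := LinearMap.congr_fun h.sum w.1
    simpa [LinearMap.sum_apply] using this
  left a := LinearMap.ext fun w => Subtype.ext (LinearMap.congr_fun (h.left a) w.1)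
  right a := LinearMap.ext fun w => Subtype.ext (LinearMap.congr_fun (h.right a) w.1)
  rel := by
    refine LinearMap.ext fun w => Subtype.ext ?_
    have := LinearMap.congr_fun h.rel w.1
    simpa [LinearMap.sum_apply] using this

lemma finrank_range_restrict (f : Module.End ℂ W) {S : Submodule ℂ W} (hf : ∀ w ∈ S, f w ∈ S) :
    Module.finrank ℂ (LinearMap.range (f.restrict hf)) = Module.finrank ℂ (S.map f) := by
  have : (LinearMap.range (f.restrict hf)).map S.subtype = S.map f := by
    ext w
    constructor
    · rintro ⟨_, ⟨v, rfl⟩, rfl⟩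
      exact ⟨v, v.2, rfl⟩
    · rintro ⟨v, hv, rfl⟩
      exact ⟨_, ⟨⟨v, hv⟩, rfl⟩, rfl⟩
  rw [← this]
  exact (Submodule.equivMapOfInjective _ S.subtype_injective _).finrank_eq

lemma IsDeformedRep.sum_weight_map [FiniteDimensional ℂ W] (h : IsDeformedRep lam e x)
    {S : Submodule ℂ W} (hS : IsSubrep e x S) :
    ∑ i, lam i * Module.finrank ℂ (S.map (e i)) = 0 := by
  simpa only [finrank_range_restrict] using (h.restrict hS).sum_weight

lemma IsDeformedRep.sum_finrank_map [FiniteDimensional ℂ W] (h : IsDeformedRep lam e x)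
    {S : Submodule ℂ W} (hS : IsSubrep e x S) :
    ∑ i, Module.finrank ℂ (S.map (e i)) = Module.finrank ℂ S := by
  simpa only [finrank_range_restrict] using (h.restrict hS).sum_finrank

/-- The dimension vector of a proper nonzero subrepresentation lies strictly between. -/
lemma IsDeformedRep.finrank_map_between [FiniteDimensional ℂ W] (h : IsDeformedRep lam e x)
    {S : Submodule ℂ W} (hS : IsSubrep e x S) (hbot : S ≠ ⊥) (htop : S ≠ ⊤) :
    (∀ i, Module.finrank ℂ (S.map (e i)) ≤ Module.finrank ℂ (LinearMap.range (e i))) ∧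
    (∃ i, Module.finrank ℂ (S.map (e i)) ≠ 0) ∧
    ∃ i, Module.finrank ℂ (S.map (e i)) ≠ Module.finrank ℂ (LinearMap.range (e i)) := by
  refine ⟨fun i => Submodule.finrank_mono LinearMap.map_le_range, ?_, ?_⟩
  · by_contra! h0
    have := h.sum_finrank_map hS
    rw [Finset.sum_congr rfl fun i _ => h0 i, Finset.sum_const_zero] at this
    exact hbot (Submodule.finrank_eq_zero.1 this.symm)
  · by_contra! h0
    have := h.sum_finrank_map hS
    rw [Finset.sum_congr rfl fun i _ => h0 i, h.sum_finrank] at this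
    exact htop (Submodule.eq_top_of_finrank_eq this.symm)

end Trace

end LooplessQuiver

open LooplessQuiver in
lemma NilCentralCharge.exists_stable_of_hasGenericRep {Q : LooplessQuiver} {α : Q.V → ℤ}
    (hα : α ≠ 0) (Z : NilCentralCharge Q)
    (hgen : ∀ β : Q.V → ℤ, (∀ i, 0 ≤ β i) → (∀ i, β i ≤ α i) → β ≠ 0 → β ≠ α →
      (Z.Z β / Z.Z α).im ≠ 0) (hrep : HasGenericRep α) :
    ∃ M : ModuleCat.{0} Q.Preproj, IsStableMod Z M ∧ Q.dimVec M = α := by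
  obtain ⟨lam, hlam, W, _, _, _, e, x, h, hdim⟩ := hrep
  have hpos : ∀ i, 0 ≤ α i := fun i => by rw [← hdim i]; positivity
  have hZα : Z.Z α ≠ 0 := by
    intro h0
    have := (Z.upper α hpos hα).1
    simp [h0] at this
  have hW : Nontrivial W := by
    refine (subsingleton_or_nontrivial W).resolve_left fun hs => hα (funext fun i => ?_)
    rw [← hdim i, Submodule.finrank_eq_zero.2 (Subsingleton.elim _ _)]
    rfl
  have simple : ∀ S, IsSubrep e x S → S = ⊥ ∨ S = ⊤ := by
    intro S hS
    by_contra! hne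
    obtain ⟨h1, ⟨j, hj⟩, ⟨k, hk⟩⟩ := h.finrank_map_between hS hne.1 hne.2
    let β : Q.V → ℤ := fun i => Module.finrank ℂ (S.map (e i))
    obtain ⟨p, q, hq, hpq⟩ := hlam.2 β (by simpa [β] using h.sum_weight_map hS)
    refine hgen β (fun i => by positivity) (fun i => ?_) (fun h0 => hj ?_) (fun h0 => hk ?_) ?_
    · rw [← hdim i]
      exact Int.ofNat_le.2 (h1 i)
    · exact Int.ofNat_inj.1 (congrFun h0 j)
    · have := congrFun h0 k
      rw [← hdim k] at this
      exact Int.ofNat_inj.1 this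
    · have h2 : (q : ℂ) * Z.Z β = p * Z.Z α := by
        have := congrArg Z.Z hpq
        rwa [map_zsmul, map_zsmul, zsmul_eq_mul, zsmul_eq_mul] at this
      have hq' : (q : ℂ) ≠ 0 := by exact_mod_cast hq
      have h3 : Z.Z β / Z.Z α = ((p / q : ℝ) : ℂ) := by
        push_cast
        rw [div_eq_div_iff hZα hq']
        linear_combination h2
      rw [h3, Complex.ofReal_im]
  let θ : Q.V → ℝ := fun i => (Z.Z (Pi.single i 1) / Z.Z α).im
  have hθ : ∀ β : Q.V → ℤ, ∑ i, θ i * β i = (Z.Z β / Z.Z α).im := by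
    intro β
    have h1 : β = ∑ i, β i • (Pi.single i 1 : Q.V → ℤ) := pi_eq_sum_univ' β
    conv_rhs => rw [h1]
    rw [map_sum, Finset.sum_div, Complex.im_sum]
    refine Finset.sum_congr rfl fun i _ => ?_
    rw [map_zsmul, zsmul_eq_mul, mul_div_assoc, ← Complex.ofReal_intCast, Complex.im_ofReal_mul,
      mul_comm]
  obtain ⟨X, _, _, _, e', x', h', hnil, hdim', hsemi⟩ := exists_semistable h simple θ (by
    have := hθ α
    rw [div_self hZα, Complex.one_im] at this
    rw [← this]
    refine Finset.sum_congr rfl fun i _ => ?_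
    rw [← hdim i, Int.cast_natCast])
  have hdimM : Q.dimVec h'.toModule = α := funext fun i => by
    rw [h'.dimVec_toModule, hdim', hdim]
  refine ⟨h'.toModule, ⟨h'.finDim_toModule, h'.isNilpotentMod_toModule hnil, ?_, ?_⟩, hdimM⟩
  · by_contra! h0
    have hsub : Subsingleton X := ⟨fun a b => by
      have ha := h0 (h'.carrierEquiv.symm a)
      have hb := h0 (h'.carrierEquiv.symm b)
      exact h'.carrierEquiv.symm.injective (ha.trans hb.symm)⟩
    refine hα (funext fun i => ?_)
    rw [← hdim i, ← hdim' i, Submodule.finrank_eq_zero.2 (Subsingleton.elim _ _)]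
    rfl
  · intro N hbot htop
    have hS := h'.isSubrep_subspace N
    obtain ⟨h1, ⟨j, hj⟩, ⟨k, hk⟩⟩ :=
      h'.finrank_map_between hS (h'.subspace_ne_bot hbot) (h'.subspace_ne_top htop)
    rw [hdimM]
    set β := Q.dimVec (ModuleCat.of Q.Preproj N) with hβ
    have hβi : ∀ i, β i = Module.finrank ℂ ((h'.subspace N).map (e' i)) := h'.dimVec_of N
    have hβ0 : β ≠ 0 := fun h0 => hj (by
      have := hβi j
      rw [h0] at this
      exact Int.ofNat_inj.1 this.symm)
    have hβpos : ∀ i, 0 ≤ β i := fun i => by rw [hβi]; positivity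
    have hne := hgen β hβpos (fun i => by
        rw [hβi, ← hdim i, ← hdim' i]
        exact_mod_cast h1 i) hβ0 (fun h0 => hk (by
        have := hβi k
        rw [h0, ← hdim k, ← hdim' k] at this
        exact_mod_cast this.symm))
    have hle : (Z.Z β / Z.Z α).im ≤ 0 := by
      rw [← hθ β]
      refine le_trans (le_of_eq ?_) (hsemi _ hS)
      refine Finset.sum_congr rfl fun i _ => ?_
      rw [hβi, Int.cast_natCast]
    have hlt := lt_of_le_of_ne hle hne
    have hub := Z.upper β hβpos hβ0
    have hua := Z.upper α hpos hα
    refine div_lt_div_of_pos_right ?_ Real.pi_pos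
    by_contra! hge
    have hZβ : Z.Z β ≠ 0 := by
      intro h0
      have := hub.1
      simp [h0] at this
    have harg : (Z.Z β / Z.Z α).arg = (Z.Z β).arg - (Z.Z α).arg := by
      have hc := Complex.arg_div_coe_angle hZβ hZα
      have hm : (Z.Z β).arg - (Z.Z α).arg ∈ Set.Ioc (-Real.pi) Real.pi := by
        constructor <;> linarith [hub.1, hub.2, hua.1, hua.2, Real.pi_pos]
      rw [← Real.Angle.coe_sub] at hc
      have := congrArg Real.Angle.toReal hc
      rwa [Complex.arg_coe_angle_toReal_eq_arg, Real.Angle.toReal_coe_eq_self_iff_mem_Ioc.2 hm]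
        at this
    have := Complex.arg_neg_iff.2 hlt
    linarith

namespace LooplessQuiver

variable {Q : LooplessQuiver}

section DoubleQuiver

/-- The reverse of an arrow of the double quiver. -/
def rev (b : Q.DArrow) : Q.DArrow := b.swap

/-- The sign of an arrow of the double quiver in the preprojective relation. -/
def sgn : Q.DArrow → ℂ
  | .inl _ => 1
  | .inr _ => -1

@[simp] lemma rev_rev (b : Q.DArrow) : rev (rev b) = b := Sum.swap_swap b

@[simp] lemma dsrc_rev (b : Q.DArrow) : Q.dsrc (rev b) = Q.dtgt b := by cases b <;> rfl

@[simp] lemma dtgt_rev (b : Q.DArrow) : Q.dtgt (rev b) = Q.dsrc b := by cases b <;> rfl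

@[simp] lemma sgn_rev (b : Q.DArrow) : sgn (rev b) = -sgn b := by
  cases b <;> simp [rev, sgn]

@[simp] lemma sgn_mul_self (b : Q.DArrow) : sgn b * sgn b = 1 := by
  cases b <;> simp [sgn]

lemma dsrc_ne_dtgt (b : Q.DArrow) : Q.dsrc b ≠ Q.dtgt b := by
  cases b with
  | inl a => exact Q.no_loops a
  | inr a => exact (Q.no_loops a).symm

lemma form_simRoot (v : Q.V → ℤ) (i : Q.V) :
    Q.form v (Q.simRoot i) =
      2 * v i - ∑ b : Q.DArrow, if Q.dsrc b = i then v (Q.dtgt b) else 0 := by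
  simp only [form, simRoot, Fintype.sum_sum_type, dsrc, dtgt, ← Finset.sum_add_distrib,
    Pi.single_apply, mul_ite, mul_one, mul_zero, Finset.sum_ite_eq', Finset.mem_univ, if_true]
  congr 1
  exact Finset.sum_congr rfl fun a _ => add_comm _ _

lemma form_simRoot_self (i : Q.V) : Q.form (Q.simRoot i) (Q.simRoot i) = 2 := by
  rw [form_simRoot, simRoot, Pi.single_eq_same, mul_one, sub_eq_self]
  refine Finset.sum_eq_zero fun b _ => ?_
  split_ifs with hs
  · exact Pi.single_eq_of_ne (fun ht => dsrc_ne_dtgt b (hs.trans ht.symm)) _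
  · rfl

lemma IsDeformedRep.rel_double {W : Type*} [AddCommGroup W] [Module ℂ W] {lam : Q.V → ℂ}
    {e : Q.V → Module.End ℂ W} {x : Q.DArrow → Module.End ℂ W} (h : IsDeformedRep lam e x)
    (w : W) : ∑ b, sgn b • x b (x (rev b) w) = ∑ i, lam i • e i w := by
  have := LinearMap.congr_fun h.rel w
  simp only [LinearMap.sum_apply, LinearMap.sub_apply, Module.End.mul_apply,
    LinearMap.smul_apply] at this
  rw [← this, Fintype.sum_sum_type, ← Finset.sum_add_distrib]
  refine Finset.sum_congr rfl fun a _ => ?_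
  simp [sgn, rev, sub_eq_add_neg]

end DoubleQuiver

section Reflection

variable {W : Type*} [AddCommGroup W] [Module ℂ W] {lam : Q.V → ℂ}
  {e : Q.V → Module.End ℂ W} {x : Q.DArrow → Module.End ℂ W}

lemma IsDeformedRep.e_e (h : IsDeformedRep lam e x) (i j : Q.V) (w : W) :
    e i (e j w) = if i = j then e i w else 0 := by
  have := LinearMap.congr_fun (h.mul i j) w
  rw [Module.End.mul_apply] at this
  rw [this]
  split_ifs <;> rfl

lemma IsDeformedRep.e_x (h : IsDeformedRep lam e x) (i : Q.V) (b : Q.DArrow) (w : W) :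
    e i (x b w) = if i = Q.dtgt b then x b w else 0 := by
  have hb : e (Q.dtgt b) (x b w) = x b w := LinearMap.congr_fun (h.left b) w
  rw [← hb, h.e_e, hb]
  split_ifs with hi
  · rw [hi, hb]
  · rfl

lemma IsDeformedRep.x_e (h : IsDeformedRep lam e x) (i : Q.V) (b : Q.DArrow) (w : W) :
    x b (e i w) = if i = Q.dsrc b then x b w else 0 := by
  have hb : ∀ w, x b (e (Q.dsrc b) w) = x b w := LinearMap.congr_fun (h.right b)
  rw [← hb (e i w), h.e_e]
  split_ifs with h1 h2 h2
  · exact hb w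
  · exact absurd h1.symm h2
  · exact absurd h2.symm h1
  · exact map_zero _

lemma IsDeformedRep.e_rel_double (h : IsDeformedRep lam e x) (i : Q.V) (w : W) :
    (∑ b, if Q.dtgt b = i then sgn b • x b (x (rev b) w) else 0) = lam i • e i w := by
  have := congrArg (e i) (h.rel_double w)
  simp only [map_sum, map_smul, h.e_x, h.e_e] at this
  rw [Finset.sum_eq_single i (fun j _ hj => by rw [if_neg hj.symm, smul_zero])
    (fun hi => absurd (Finset.mem_univ i) hi), if_pos rfl] at this
  rw [← this]
  refine Finset.sum_congr rfl fun b _ => ?_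
  by_cases hb : Q.dtgt b = i
  · rw [if_pos hb, if_pos hb.symm]
  · rw [if_neg hb, if_neg (Ne.symm hb), smul_zero]

/-- The underlying space of the reflection of a deformed representation at the vertex `i`. -/
def reflSpace (e : Q.V → Module.End ℂ W) (x : Q.DArrow → Module.End ℂ W) (i : Q.V) :
    Submodule ℂ (W × (Q.DArrow → W)) where
  carrier := {u | e i u.1 = 0 ∧ (∀ b, Q.dtgt b = i → e (Q.dsrc b) (u.2 b) = u.2 b) ∧
    (∀ b, Q.dtgt b ≠ i → u.2 b = 0) ∧ ∑ b, sgn b • x b (u.2 b) = 0}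
  add_mem' := by
    rintro u v ⟨h1, h2, h3, h4⟩ ⟨h1', h2', h3', h4'⟩
    refine ⟨by simp [h1, h1'], fun b hb => by simp [h2 b hb, h2' b hb],
      fun b hb => by simp [h3 b hb, h3' b hb], ?_⟩
    simp [Finset.sum_add_distrib, h4, h4']
  zero_mem' := by simp
  smul_mem' := by
    rintro c u ⟨h1, h2, h3, h4⟩
    refine ⟨by simp [h1], fun b hb => by simp [h2 b hb], fun b hb => by simp [h3 b hb], ?_⟩
    have : ∀ b, sgn b • x b ((c • u).2 b) = c • sgn b • x b (u.2 b) := fun b => by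
      rw [Prod.smul_snd, Pi.smul_apply, map_smul, smul_comm]
    rw [Finset.sum_congr rfl fun b _ => this b, ← Finset.smul_sum, h4, smul_zero]

/-- The vertex idempotents of the reflected representation. -/
def reflE (e : Q.V → Module.End ℂ W) (i j : Q.V) : Module.End ℂ (W × (Q.DArrow → W)) :=
  (e j).prodMap (if j = i then LinearMap.id else 0)

open Classical in
/-- The arrows of the reflected representation. -/
noncomputable def reflX (lam : Q.V → ℂ) (e : Q.V → Module.End ℂ W)
    (x : Q.DArrow → Module.End ℂ W) (i : Q.V) (b : Q.DArrow) :
    Module.End ℂ (W × (Q.DArrow → W)) :=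
  if Q.dtgt b = i then
    LinearMap.prod 0 (LinearMap.pi fun c : Q.DArrow =>
      ((if Q.dtgt c = i then x (rev c) * x b else 0) -
        (if c = b then (sgn b * lam i) • e (Q.dsrc b) else 0)) ∘ₗ LinearMap.fst ℂ W (Q.DArrow → W))
  else
    LinearMap.prod (x b ∘ₗ LinearMap.fst ℂ W (Q.DArrow → W) +
      LinearMap.proj (rev b) ∘ₗ LinearMap.snd ℂ W (Q.DArrow → W)) 0

/-- The reflected weight. -/
def reflWeight (lam : Q.V → ℂ) (i j : Q.V) : ℂ :=
  lam j - lam i * Q.form (Q.simRoot j) (Q.simRoot i)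

lemma reflE_apply (i j : Q.V) (u : W × (Q.DArrow → W)) :
    reflE e i j u = (e j u.1, if j = i then u.2 else 0) := by
  rw [reflE, LinearMap.prodMap_apply]
  split_ifs <;> rfl

lemma reflX_fst_of_eq {i : Q.V} {b : Q.DArrow} (hb : Q.dtgt b = i) (u : W × (Q.DArrow → W)) :
    (reflX lam e x i b u).1 = 0 := by
  rw [reflX, if_pos hb]
  rfl

open Classical in
lemma reflX_snd_of_eq {i : Q.V} {b : Q.DArrow} (hb : Q.dtgt b = i) (u : W × (Q.DArrow → W))
    (c : Q.DArrow) :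
    (reflX lam e x i b u).2 c = (if Q.dtgt c = i then x (rev c) (x b u.1) else 0) -
        (if c = b then (sgn b * lam i) • e (Q.dsrc b) u.1 else 0) := by
  rw [reflX, if_pos hb]
  change (((if Q.dtgt c = i then x (rev c) * x b else 0) -
        (if c = b then (sgn b * lam i) • e (Q.dsrc b) else 0) : Module.End ℂ W)) u.1 = _
  rw [LinearMap.sub_apply]
  congr 1
  · split_ifs <;> rfl
  · split_ifs <;> rfl

lemma reflX_fst_of_ne {i : Q.V} {b : Q.DArrow} (hb : Q.dtgt b ≠ i) (u : W × (Q.DArrow → W)) :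
    (reflX lam e x i b u).1 = x b u.1 + u.2 (rev b) := by
  rw [reflX, if_neg hb]
  rfl

lemma reflX_snd_of_ne {i : Q.V} {b : Q.DArrow} (hb : Q.dtgt b ≠ i) (u : W × (Q.DArrow → W)) :
    (reflX lam e x i b u).2 = 0 := by
  rw [reflX, if_neg hb]
  rfl

lemma isSubrep_reflSpace (h : IsDeformedRep lam e x) (i : Q.V) :
    IsSubrep (reflE e i) (reflX lam e x i) (reflSpace e x i) := by
  constructor
  · rintro j u ⟨h1, h2, h3, h4⟩
    rw [reflE_apply]
    refine ⟨?_, fun b hb => ?_, fun b hb => ?_, ?_⟩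
    · dsimp only
      rw [h.e_e]
      split_ifs
      · exact h1
      · rfl
    · dsimp only
      split_ifs
      · exact h2 b hb
      · exact map_zero _
    · dsimp only
      split_ifs
      · exact h3 b hb
      · rfl
    · dsimp only
      split_ifs
      · exact h4
      · simp
  · rintro b u ⟨h1, h2, h3, h4⟩
    by_cases hb : Q.dtgt b = i
    · refine ⟨?_, fun c hc => ?_, fun c hc => ?_, ?_⟩
      · rw [reflX_fst_of_eq hb, map_zero]
      · rw [reflX_snd_of_eq hb, if_pos hc, map_sub, h.e_x, dtgt_rev, if_pos rfl]
        congr 1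
        split_ifs with hcb
        · rw [map_smul, h.e_e, hcb, if_pos rfl]
        · exact map_zero _
      · rw [reflX_snd_of_eq hb, if_neg hc, if_neg (fun hcb : c = b => hc (by rw [hcb, hb])), sub_zero]
      · classical
        have hterm : ∀ c, sgn c • x c ((reflX lam e x i b u).2 c) =
            (if Q.dtgt c = i then sgn c • x c (x (rev c) (x b u.1)) else 0) -
              if c = b then lam i • x b u.1 else 0 := by
          intro c
          rw [reflX_snd_of_eq hb, map_sub, smul_sub]
          congr 1
          · split_ifs
            · rfl
            · rw [map_zero, smul_zero]
          · split_ifs with hcb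
            · rw [hcb, map_smul, h.x_e, if_pos rfl, smul_smul, ← mul_assoc, sgn_mul_self, one_mul]
            · rw [map_zero, smul_zero]
        rw [Finset.sum_congr rfl fun c _ => hterm c, Finset.sum_sub_distrib, h.e_rel_double,
          Finset.sum_ite_eq' Finset.univ b, if_pos (Finset.mem_univ b), h.e_x, if_pos hb.symm,
          sub_self]
    · refine ⟨?_, fun c hc => ?_, fun c hc => ?_, ?_⟩
      · rw [reflX_fst_of_ne hb, map_add, h.e_x, if_neg (Ne.symm hb), zero_add]
        by_cases hs : Q.dsrc b = i
        · have := h2 (rev b) (by rw [dtgt_rev, hs])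
          rw [dsrc_rev] at this
          rw [← this, h.e_e, if_neg (Ne.symm hb)]
        · rw [h3 (rev b) (by rwa [dtgt_rev]), map_zero]
      · simp [reflX_snd_of_ne hb]
      · simp [reflX_snd_of_ne hb]
      · simp [reflX_snd_of_ne hb]

lemma sum_reflWeight_smul {i : Q.V} {k : W} (hk : e i k = 0) :
    ∑ j, reflWeight lam i j • e j k =
      ∑ j, lam j • e j k + ∑ b, if Q.dsrc b = i then lam i • e (Q.dtgt b) k else 0 := by
  have hterm : ∀ j, reflWeight lam i j • e j k = lam j • e j k +
      ∑ b : Q.DArrow, if Q.dsrc b = i then (if j = Q.dtgt b then lam i • e j k else 0) else 0 := by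
    intro j
    by_cases hj : j = i
    · subst hj
      simp [hk]
    · rw [reflWeight, form_simRoot, sub_smul, sub_eq_add_neg]
      congr 1
      rw [simRoot, Pi.single_eq_of_ne (Ne.symm hj), mul_zero, zero_sub, Int.cast_neg, mul_neg,
        neg_smul, neg_neg, Int.cast_sum, Finset.mul_sum, Finset.sum_smul]
      refine Finset.sum_congr rfl fun b _ => ?_
      split_ifs with h1 h2
      · rw [h2, Pi.single_eq_same, Int.cast_one, mul_one]
      · rw [Pi.single_eq_of_ne (Ne.symm h2), Int.cast_zero, mul_zero, zero_smul]
      · rw [Int.cast_zero, mul_zero, zero_smul]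
  rw [Finset.sum_congr rfl fun j _ => hterm j, Finset.sum_add_distrib]
  congr 1
  rw [Finset.sum_comm]
  refine Finset.sum_congr rfl fun b _ => ?_
  split_ifs
  · rw [Finset.sum_ite_eq' Finset.univ (Q.dtgt b), if_pos (Finset.mem_univ _)]
  · exact Finset.sum_const_zero

/-- The reflected operators satisfy the relation for the reflected weight. -/
lemma reflX_rel (h : IsDeformedRep lam e x) {i : Q.V} {u : W × (Q.DArrow → W)}
    (hu : u ∈ reflSpace e x i) :
    ∑ b, sgn b • reflX lam e x i b (reflX lam e x i (rev b) u) =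
      ∑ j, reflWeight lam i j • reflE e i j u := by
  obtain ⟨h1, h2, h3, h4⟩ := hu
  refine Prod.ext ?_ (funext fun c => ?_)
  · rw [Prod.fst_sum, Prod.fst_sum]
    simp only [Prod.smul_fst, reflE_apply]
    rw [sum_reflWeight_smul h1, ← h.rel_double]
    have hterm : ∀ b, sgn b • (reflX lam e x i b (reflX lam e x i (rev b) u)).1 =
        sgn b • x b (x (rev b) u.1) - (if Q.dtgt b = i then sgn b • x b (x (rev b) u.1) else 0) +
          if Q.dsrc b = i then lam i • e (Q.dtgt b) u.1 else 0 := by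
      intro b
      by_cases hb : Q.dtgt b = i
      · rw [reflX_fst_of_eq hb, if_pos hb, if_neg (fun hs => dsrc_ne_dtgt b (hs.trans hb.symm))]
        simp
      · rw [reflX_fst_of_ne hb, if_neg hb, sub_zero]
        by_cases hs : Q.dsrc b = i
        · have hr : Q.dtgt (rev b) = i := by rw [dtgt_rev, hs]
          rw [reflX_fst_of_eq hr, reflX_snd_of_eq hr, if_pos hr, if_pos rfl, if_pos hs, rev_rev,
            dsrc_rev, map_zero, zero_add, sgn_rev, neg_mul, neg_smul, sub_neg_eq_add, smul_add,
            smul_smul, ← mul_assoc, sgn_mul_self, one_mul]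
        · have hr : Q.dtgt (rev b) ≠ i := by rwa [dtgt_rev]
          rw [reflX_fst_of_ne hr, reflX_snd_of_ne hr, if_neg hs, rev_rev, h3 b hb, add_zero,
            Pi.zero_apply, add_zero, add_zero]
    rw [Finset.sum_congr rfl fun b _ => hterm b, Finset.sum_add_distrib, Finset.sum_sub_distrib,
      h.e_rel_double, h1, smul_zero, sub_zero]
  · classical
    rw [Prod.snd_sum, Prod.snd_sum, Finset.sum_apply, Finset.sum_apply]
    simp only [Prod.smul_snd, Pi.smul_apply, reflE_apply]
    rw [Finset.sum_eq_single i (fun j _ hj => by rw [if_neg hj, Pi.zero_apply, smul_zero])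
      (fun hi => absurd (Finset.mem_univ i) hi), if_pos rfl]
    have hweight : reflWeight lam i i = -lam i := by
      rw [reflWeight, form_simRoot_self]
      push_cast
      ring
    rw [hweight]
    have hterm : ∀ b, sgn b • (reflX lam e x i b (reflX lam e x i (rev b) u)).2 c =
        (if Q.dtgt c = i then x (rev c) ((if Q.dtgt b = i then sgn b • x b (x (rev b) u.1) else 0) +
          sgn b • x b (u.2 b)) else 0) - if b = c then lam i • u.2 c else 0 := by
      intro b
      by_cases hb : Q.dtgt b = i
      · have hr : Q.dtgt (rev b) ≠ i := by
          rw [dtgt_rev]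
          exact fun hs => dsrc_ne_dtgt b (hs.trans hb.symm)
        rw [reflX_snd_of_eq hb, reflX_fst_of_ne hr, rev_rev, if_pos hb, smul_sub]
        congr 1
        · split_ifs
          · rw [map_add, ← smul_add, map_smul, map_add]
          · exact smul_zero _
        · by_cases hcb : b = c
          · subst hcb
            rw [if_pos rfl, if_pos rfl, smul_smul, ← mul_assoc, sgn_mul_self, one_mul, map_add,
              h2 b hb, h.e_x, dtgt_rev, if_pos rfl]
            have : x (rev b) u.1 = 0 := by
              have h5 := h.x_e i (rev b) u.1
              rwa [dsrc_rev, if_pos hb.symm, h1, map_zero, eq_comm] at h5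
            rw [this, zero_add]
          · rw [if_neg hcb, if_neg (Ne.symm hcb), smul_zero]
      · rw [reflX_snd_of_ne hb, if_neg hb, h3 b hb, Pi.zero_apply, map_zero, smul_zero, add_zero,
          map_zero, ite_self, zero_sub, eq_comm, neg_eq_zero]
        split_ifs with hbc
        · rw [← hbc, h3 b hb, smul_zero]
        · rfl
    rw [Finset.sum_congr rfl fun b _ => hterm b, Finset.sum_sub_distrib,
      Finset.sum_ite_eq' Finset.univ c, if_pos (Finset.mem_univ c), neg_smul]
    have hzero : (∑ b, if Q.dtgt c = i then x (rev c) ((if Q.dtgt b = i then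
        sgn b • x b (x (rev b) u.1) else 0) + sgn b • x b (u.2 b)) else 0) = 0 := by
      split_ifs
      · rw [← map_sum, Finset.sum_add_distrib, h.e_rel_double, h1, h4, smul_zero, add_zero,
          map_zero]
      · exact Finset.sum_const_zero
    rw [hzero, zero_sub]

lemma isDeformedRep_refl (h : IsDeformedRep lam e x) (i : Q.V) :
    IsDeformedRep (reflWeight lam i)
      (fun j => (reflE e i j).restrict ((isSubrep_reflSpace h i).1 j))
      (fun b => (reflX lam e x i b).restrict ((isSubrep_reflSpace h i).2 b)) where
  mul j l := by
    refine LinearMap.ext fun u => Subtype.ext ?_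
    have h1 : reflE e i j (reflE e i l u.1) = if j = l then reflE e i j u.1 else 0 := by
      simp only [reflE_apply, h.e_e]
      split_ifs with h1 h2 h3 h3 <;> simp_all
    split_ifs with hjl
    · rw [if_pos hjl] at h1
      exact h1
    · rw [if_neg hjl] at h1
      exact h1
  sum := by
    refine LinearMap.ext fun u => Subtype.ext ?_
    have h1 : ∑ j, reflE e i j u.1 = u.1 := by
      refine Prod.ext ?_ ?_
      · simp only [Prod.fst_sum, reflE_apply]
        simpa using LinearMap.congr_fun h.sum u.1.1
      · simp only [Prod.snd_sum, reflE_apply]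
        simp
    simpa [LinearMap.sum_apply] using h1
  left b := by
    refine LinearMap.ext fun u => Subtype.ext ?_
    obtain ⟨u, h1, h2, h3, h4⟩ := u
    change reflE e i (Q.dtgt b) (reflX lam e x i b u) = reflX lam e x i b u
    rw [reflE_apply]
    by_cases hb : Q.dtgt b = i
    · rw [if_pos hb, reflX_fst_of_eq hb, map_zero, ← reflX_fst_of_eq hb u]
    · refine Prod.ext ?_ (by rw [if_neg hb, reflX_snd_of_ne hb])
      simp only
      rw [reflX_fst_of_ne hb, map_add, h.e_x, if_pos rfl]
      congr 1
      by_cases hs : Q.dsrc b = i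
      · have := h2 (rev b) (by rw [dtgt_rev, hs])
        rwa [dsrc_rev] at this
      · rw [h3 (rev b) (by rwa [dtgt_rev]), map_zero]
  right b := by
    refine LinearMap.ext fun u => Subtype.ext ?_
    obtain ⟨u, h1, h2, h3, h4⟩ := u
    change reflX lam e x i b (reflE e i (Q.dsrc b) u) = reflX lam e x i b u
    by_cases hb : Q.dtgt b = i
    · refine Prod.ext ?_ (funext fun c => ?_)
      · rw [reflX_fst_of_eq hb, reflX_fst_of_eq hb]
      · rw [reflX_snd_of_eq hb, reflX_snd_of_eq hb, reflE_apply, h.x_e, if_pos rfl, h.e_e,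
          if_pos rfl]
    · refine Prod.ext ?_ (by rw [reflX_snd_of_ne hb, reflX_snd_of_ne hb])
      rw [reflX_fst_of_ne hb, reflX_fst_of_ne hb, reflE_apply, h.x_e, if_pos rfl]
      congr 1
      simp only
      split_ifs with hs
      · rfl
      · rw [h3 (rev b) (by rwa [dtgt_rev]), Pi.zero_apply]
  rel := by
    refine LinearMap.ext fun u => Subtype.ext ?_
    have h1 := reflX_rel h u.2
    rw [Fintype.sum_sum_type, ← Finset.sum_add_distrib] at h1
    have h2 : ∀ a : Q.A, sgn (.inl a) • reflX lam e x i (.inl a) (reflX lam e x i (rev (.inl a)) u)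
        + sgn (.inr a) • reflX lam e x i (.inr a) (reflX lam e x i (rev (.inr a)) u) =
        reflX lam e x i (.inl a) (reflX lam e x i (.inr a) u) -
          reflX lam e x i (.inr a) (reflX lam e x i (.inl a) u) := by
      intro a
      simp [sgn, rev, sub_eq_add_neg]
    rw [Finset.sum_congr rfl fun a _ => h2 a] at h1
    simpa [LinearMap.sum_apply] using h1

lemma finrank_refl_of_ne (h : IsDeformedRep lam e x) {i j : Q.V} (hij : j ≠ i) :
    Module.finrank ℂ (LinearMap.range
      ((reflE e i j).restrict ((isSubrep_reflSpace h i).1 j))) =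
      Module.finrank ℂ (LinearMap.range (e j)) := by
  rw [finrank_range_restrict]
  have : (reflSpace e x i).map (reflE e i j) =
      (LinearMap.range (e j)).map (LinearMap.inl ℂ W (Q.DArrow → W)) := by
    ext u
    constructor
    · rintro ⟨v, _, rfl⟩
      exact ⟨e j v.1, ⟨v.1, rfl⟩, by rw [reflE_apply, if_neg hij]; rfl⟩
    · rintro ⟨_, ⟨w, rfl⟩, rfl⟩
      refine ⟨(e j w, 0), ⟨?_, ?_, ?_, ?_⟩, ?_⟩
      · rw [h.e_e, if_neg (Ne.symm hij)]
      · simp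
      · simp
      · simp
      · rw [reflE_apply, if_neg hij]
        simp [h.e_e]
  rw [this]
  exact (Submodule.equivMapOfInjective _ LinearMap.inl_injective _).finrank_eq.symm

end Reflection

lemma sum_reflWeight (lam : Q.V → ℂ) (i : Q.V) (β : Q.V → ℤ) :
    ∑ j, reflWeight lam i j * β j =
      ∑ j, lam j * ((β - Q.form β (Q.simRoot i) • Q.simRoot i) j : ℤ) := by
  have hform : Q.form β (Q.simRoot i) = ∑ j, Q.form (Q.simRoot j) (Q.simRoot i) * β j := by
    simp only [form_simRoot, sub_mul, Finset.sum_sub_distrib, Finset.sum_mul]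
    congr 1
    · simp [simRoot, Pi.single_apply]
    · rw [Finset.sum_comm]
      refine Finset.sum_congr rfl fun b _ => ?_
      split_ifs <;> simp [simRoot, Pi.single_apply]
  have h1 : ∑ j, lam j * ((β - Q.form β (Q.simRoot i) • Q.simRoot i) j : ℤ) =
      ∑ j, lam j * β j - lam i * Q.form β (Q.simRoot i) := by
    simp only [Pi.sub_apply, Pi.smul_apply, simRoot, smul_eq_mul, Int.cast_sub, mul_sub,
      Finset.sum_sub_distrib]
    congr 1
    simp [Pi.single_apply]
  rw [h1, hform, Int.cast_sum, Finset.mul_sum, ← Finset.sum_sub_distrib]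
  refine Finset.sum_congr rfl fun j _ => ?_
  rw [reflWeight]
  push_cast
  ring

lemma form_sub_smul (v w : Q.V → ℤ) (c : ℤ) (i : Q.V) :
    Q.form (v - c • w) (Q.simRoot i) = Q.form v (Q.simRoot i) - c * Q.form w (Q.simRoot i) := by
  have h1 : (∑ b : Q.DArrow, if Q.dsrc b = i then (v - c • w) (Q.dtgt b) else 0) =
      (∑ b : Q.DArrow, if Q.dsrc b = i then v (Q.dtgt b) else 0) -
        c * ∑ b : Q.DArrow, if Q.dsrc b = i then w (Q.dtgt b) else 0 := by
    rw [Finset.mul_sum, ← Finset.sum_sub_distrib]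
    refine Finset.sum_congr rfl fun b _ => ?_
    split_ifs <;> simp
  rw [form_simRoot, form_simRoot, form_simRoot, h1, Pi.sub_apply, Pi.smul_apply, smul_eq_mul]
  ring

lemma reflect_reflect (i : Q.V) (β : Q.V → ℤ) :
    (β - Q.form β (Q.simRoot i) • Q.simRoot i) -
      Q.form (β - Q.form β (Q.simRoot i) • Q.simRoot i) (Q.simRoot i) • Q.simRoot i = β := by
  rw [form_sub_smul, form_simRoot_self]
  funext j
  simp only [Pi.sub_apply, Pi.smul_apply, smul_eq_mul]
  ring

/-- The reflection of a vector having a generic representation has one, up to sign. -/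
lemma HasGenericRep.reflect {β : Q.V → ℤ} (hβ : HasGenericRep β) (i : Q.V) :
    HasGenericRep (β - Q.form β (Q.simRoot i) • Q.simRoot i) ∨
      β - Q.form β (Q.simRoot i) • Q.simRoot i = -β := by
  obtain ⟨lam, hlam, W, _, _, _, e, x, h, hdim⟩ := hβ
  set γ := β - Q.form β (Q.simRoot i) • Q.simRoot i with hγ
  by_cases hi : lam i = 0
  · right
    obtain ⟨p, q, hq, hpq⟩ := hlam.2 (Q.simRoot i) (by simp [simRoot, Pi.single_apply, hi])
    have hp : p ≠ 0 := by
      rintro rfl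
      have := congrFun hpq i
      simp [simRoot, hq] at this
    have hsupp : ∀ j, j ≠ i → β j = 0 := by
      intro j hj
      have := congrFun hpq j
      simpa [simRoot, hj, hp] using this
    have hform : Q.form β (Q.simRoot i) = 2 * β i := by
      rw [form_simRoot, sub_eq_self]
      refine Finset.sum_eq_zero fun b _ => ?_
      split_ifs with hs
      · exact hsupp _ fun ht => dsrc_ne_dtgt b (hs.trans ht.symm)
      · rfl
    rw [hγ, hform]
    funext j
    by_cases hj : j = i
    · subst hj
      simp only [Pi.sub_apply, Pi.smul_apply, simRoot, Pi.single_eq_same, Pi.neg_apply,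
        smul_eq_mul]
      ring
    · simp [simRoot, hj, hsupp j hj]
  · left
    have hγγ : γ - Q.form γ (Q.simRoot i) • Q.simRoot i = β := reflect_reflect i β
    have h' := isDeformedRep_refl h i
    have hγ0 : ∑ j, reflWeight lam i j * γ j = 0 := by
      rw [sum_reflWeight, hγγ, hlam.1]
    refine ⟨reflWeight lam i, ⟨hγ0, fun δ hδ => ?_⟩, reflSpace e x i, inferInstance,
      inferInstance, inferInstance, _, _, h', ?_⟩
    · rw [sum_reflWeight] at hδ
      obtain ⟨p, q, hq, hpq⟩ := hlam.2 _ hδ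
      refine ⟨p, q, hq, ?_⟩
      have h1 : ∀ (c : ℤ) (v : Q.V → ℤ), Q.form (c • v) (Q.simRoot i) =
          c * Q.form v (Q.simRoot i) := by
        intro c v
        have := form_sub_smul 0 v (-c) i
        have h0 : Q.form 0 (Q.simRoot i) = 0 := by simp [form]
        rw [h0] at this
        simpa using this
      have h2 : ∀ (c : ℤ) (v : Q.V → ℤ), (c • v) - Q.form (c • v) (Q.simRoot i) • Q.simRoot i =
          c • (v - Q.form v (Q.simRoot i) • Q.simRoot i) := by
        intro c v
        rw [h1, smul_sub, smul_smul]
      rw [hγ, ← h2, ← hpq, h2, reflect_reflect]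
    · have hne : ∀ j, j ≠ i → (Module.finrank ℂ (LinearMap.range
          ((reflE e i j).restrict ((isSubrep_reflSpace h i).1 j))) : ℤ) = γ j := by
        intro j hj
        rw [finrank_refl_of_ne h hj, hdim, hγ]
        simp [simRoot, hj]
      intro j
      by_cases hj : j = i
      · subst hj
        have hsum := h'.sum_weight
        have hwt : reflWeight lam j j ≠ 0 := by
          rw [reflWeight, form_simRoot_self]
          push_cast
          intro h0
          apply hi
          linear_combination -h0
        rw [← Finset.add_sum_erase _ _ (Finset.mem_univ j)] at hsum hγ0
        have herase : ∑ k ∈ Finset.univ.erase j, reflWeight lam j k *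
            (Module.finrank ℂ (LinearMap.range
              ((reflE e j k).restrict ((isSubrep_reflSpace h j).1 k))) : ℂ) =
            ∑ k ∈ Finset.univ.erase j, reflWeight lam j k * (γ k : ℂ) := by
          refine Finset.sum_congr rfl fun k hk => ?_
          rw [← hne k (Finset.ne_of_mem_erase hk), Int.cast_natCast]
        rw [herase, ← hγ0] at hsum
        have := mul_left_cancel₀ hwt (add_right_cancel hsum)
        exact_mod_cast this
      · exact hne j hj

end LooplessQuiver

section GeneralPosition

open Module Filter Topology

/-- If `A` has maximal rank on the pencil `A + t B`, then `B` maps the kernel of `A` into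
the range of `A`. -/
lemma mem_range_of_finrank_pencil_le {E F : Type*} [AddCommGroup E] [Module ℂ E]
    [AddCommGroup F] [Module ℂ F] [FiniteDimensional ℂ F]
    (A B : E →ₗ[ℂ] F)
    (h : ∀ t : ℂ, finrank ℂ (LinearMap.range (A + t • B)) ≤ finrank ℂ (LinearMap.range A))
    {g : E} (hg : A g = 0) : B g ∈ LinearMap.range A := by
  by_contra hB
  let ι := (finBasis ℂ F).equivFun
  have hι : Function.Injective ι := ι.injective
  let b := finBasis ℂ (LinearMap.range A)
  choose u hu using fun k => (b k).2
  have hspan : Submodule.span ℂ (Set.range fun k => A (u k)) ≤ LinearMap.range A := by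
    rw [Submodule.span_le]
    rintro _ ⟨k, rfl⟩
    exact ⟨u k, rfl⟩
  have hli : LinearIndependent ℂ (fun k => A (u k)) := by
    have : (fun k => A (u k)) = fun k => ((b k : LinearMap.range A) : F) := funext hu
    rw [this]
    exact b.linearIndependent.map' (LinearMap.range A).subtype (Submodule.ker_subtype _)
  have hopt := hli.option (x := B g) (fun hx => hB (hspan hx))
  have hopt' := hopt.map' ι.toLinearMap (LinearMap.ker_eq_bot.mpr hι)
  let c : ℂ → Option (Fin (finrank ℂ (LinearMap.range A))) → (Fin (finrank ℂ F) → ℂ) :=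
    fun t o => Option.casesOn' o (ι (B g)) (fun k => ι (A (u k)) + t • ι (B (u k)))
  have hc : Continuous c := by
    refine continuous_pi fun o => ?_
    cases o with
    | none => exact continuous_const
    | some k => exact continuous_const.add (continuous_id.smul continuous_const)
  have hc0 : LinearIndependent ℂ (c 0) := by
    have : c 0 = ι.toLinearMap ∘ fun o => Option.casesOn' o (B g) fun k => A (u k) := by
      funext o
      cases o <;> simp [c]
    rw [this]
    exact hopt'
  have hev : ∀ᶠ t in 𝓝 (0 : ℂ), LinearIndependent ℂ (c t) :=
    (hc.tendsto 0).eventually hc0.eventually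
  obtain ⟨t, ht, ht0⟩ := ((hev.filter_mono nhdsWithin_le_nhds).and
    (self_mem_nhdsWithin : {0}ᶜ ∈ 𝓝[≠] (0 : ℂ))).exists
  have ht0 : t ≠ 0 := ht0
  let w : Option (Fin (finrank ℂ (LinearMap.range A))) → LinearMap.range (A + t • B) :=
    fun o => (A + t • B).rangeRestrict (Option.casesOn' o (t⁻¹ • g) u)
  have hw : LinearIndependent ℂ w := by
    refine LinearIndependent.of_comp (ι.toLinearMap ∘ₗ (LinearMap.range (A + t • B)).subtype) ?_
    convert ht using 1
    funext o
    cases o <;> simp [c, w, hg, ht0]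
  have := hw.fintype_card_le_finrank
  have h2 := h t
  simp only [Fintype.card_option, Fintype.card_fin] at this
  omega

end GeneralPosition

namespace LooplessQuiver

open Module

variable {Q : LooplessQuiver} {W : Type} [AddCommGroup W] [Module ℂ W]

/-- The operators commuting with all vertex idempotents. -/
def levi (e : Q.V → Module.End ℂ W) : Submodule ℂ (Module.End ℂ W) where
  carrier := {g | ∀ i, e i * g = g * e i}
  add_mem' := fun hf hg i => by rw [mul_add, add_mul, hf i, hg i]
  zero_mem' := fun i => by simp
  smul_mem' := fun c g hg i => by rw [mul_smul_comm, smul_mul_assoc, hg i]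

/-- The representations of `Q` on the graded space given by the idempotents `e`. -/
def repSpace (e : Q.V → Module.End ℂ W) : Submodule ℂ (Q.A → Module.End ℂ W) where
  carrier := {X | ∀ a, e (Q.tgt a) * X a = X a ∧ X a * e (Q.src a) = X a}
  add_mem' := fun hf hg a => by
    simp only [Pi.add_apply, mul_add, add_mul, (hf a).1, (hg a).1, (hf a).2, (hg a).2, and_self]
  zero_mem' := fun a => by simp
  smul_mem' := fun c g hg a => by
    simp only [Pi.smul_apply, mul_smul_comm, smul_mul_assoc, (hg a).1, (hg a).2, and_self]

/-- The infinitesimal action of operators on a representation `X`. -/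
def bracket (X : Q.A → Module.End ℂ W) : Module.End ℂ W →ₗ[ℂ] (Q.A → Module.End ℂ W) :=
  LinearMap.pi fun a => LinearMap.mulRight ℂ (X a) - LinearMap.mulLeft ℂ (X a)

@[simp] lemma bracket_apply (X : Q.A → Module.End ℂ W) (g : Module.End ℂ W) (a : Q.A) :
    bracket X g a = g * X a - X a * g := by
  simp [bracket]

lemma bracket_add_smul (X Y : Q.A → Module.End ℂ W) (t : ℂ) :
    bracket (X + t • Y) = bracket X + t • bracket Y := by
  refine LinearMap.ext fun g => funext fun a => ?_
  simp only [bracket_apply, LinearMap.add_apply, LinearMap.smul_apply, Pi.add_apply,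
    Pi.smul_apply, mul_add, add_mul, mul_smul_comm, smul_mul_assoc, smul_sub]
  abel

/-- There is a representation of maximal orbit dimension; its stabilizer acts trivially on
the normal space to its orbit. -/
lemma exists_generic_rep [FiniteDimensional ℂ W] (e : Q.V → Module.End ℂ W) :
    ∃ X ∈ repSpace e, ∀ ξ ∈ repSpace e, ∀ g ∈ levi e, bracket X g = 0 →
      ∃ u ∈ levi e, bracket ξ g = bracket X u := by
  let r : repSpace e → ℕ := fun X =>
    finrank ℂ (LinearMap.range ((bracket X.1).domRestrict (levi e)))
  have hbdd : BddAbove (Set.range r) := by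
    refine ⟨finrank ℂ (Q.A → Module.End ℂ W), ?_⟩
    rintro _ ⟨X, rfl⟩
    exact Submodule.finrank_le _
  obtain ⟨X, hX⟩ := Nat.sSup_mem (Set.range_nonempty r) hbdd
  refine ⟨X.1, X.2, fun ξ hξ g hg hgX => ?_⟩
  have key : ∀ t : ℂ, finrank ℂ (LinearMap.range ((bracket X.1).domRestrict (levi e) +
      t • (bracket ξ).domRestrict (levi e))) ≤
      finrank ℂ (LinearMap.range ((bracket X.1).domRestrict (levi e))) := fun t => by
    have h1 : r ⟨X.1 + t • ξ, add_mem X.2 (Submodule.smul_mem _ _ hξ)⟩ ≤ r X := by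
      rw [hX]
      exact le_csSup hbdd ⟨_, rfl⟩
    have h2 : (bracket (X.1 + t • ξ)).domRestrict (levi e) =
        (bracket X.1).domRestrict (levi e) + t • (bracket ξ).domRestrict (levi e) := by
      rw [bracket_add_smul]
      rfl
    rw [← h2]
    exact h1
  obtain ⟨u, hu⟩ := mem_range_of_finrank_pencil_le _ _ key (g := ⟨g, hg⟩) hgX
  exact ⟨u.1, u.2, hu.symm⟩

end LooplessQuiver

namespace LooplessQuiver

open Module

/-- The operators `u` with `p' u p = u`. -/
def homBlock {W : Type*} [AddCommGroup W] [Module ℂ W] (p' p : Module.End ℂ W) :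
    Submodule ℂ (Module.End ℂ W) where
  carrier := {u | p' * u = u ∧ u * p = u}
  add_mem' := fun hf hg => by
    simp only [Set.mem_ofPred_eq, mul_add, add_mul, hf.1, hg.1, hf.2, hg.2, and_self]
  zero_mem' := by simp
  smul_mem' := fun c g hg => by
    simp only [Set.mem_ofPred_eq, mul_smul_comm, smul_mul_assoc, hg.1, hg.2, and_self]

lemma finrank_homBlock {W : Type*} [AddCommGroup W] [Module ℂ W] [FiniteDimensional ℂ W]
    {p' p : Module.End ℂ W} (hp' : p' * p' = p') (hp : p * p = p) :
    finrank ℂ (homBlock p' p) =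
      finrank ℂ (LinearMap.range p') * finrank ℂ (LinearMap.range p) := by
  have hpr : ∀ w ∈ LinearMap.range p, p w = w := by
    rintro _ ⟨w, rfl⟩
    exact LinearMap.congr_fun hp w
  have hpr' : ∀ w ∈ LinearMap.range p', p' w = w := by
    rintro _ ⟨w, rfl⟩
    exact LinearMap.congr_fun hp' w
  let φ : homBlock p' p ≃ₗ[ℂ] (LinearMap.range p →ₗ[ℂ] LinearMap.range p') :=
    { toFun := fun u => p'.rangeRestrict ∘ₗ u.1 ∘ₗ (LinearMap.range p).subtype
      invFun := fun v => ⟨(LinearMap.range p').subtype ∘ₗ v ∘ₗ p.rangeRestrict,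
        LinearMap.ext fun w => hpr' _ (v _).2,
        LinearMap.ext fun w => by
          have : p.rangeRestrict (p w) = p.rangeRestrict w :=
            Subtype.ext (LinearMap.congr_fun hp w)
          simp [this]⟩
      map_add' := fun u v => LinearMap.ext fun w => Subtype.ext (map_add p' _ _)
      map_smul' := fun c u => LinearMap.ext fun w => Subtype.ext (map_smul p' _ _)
      left_inv := fun u => Subtype.ext <| by
        conv_rhs => rw [← u.2.1, ← u.2.2]
        rfl
      right_inv := fun v => LinearMap.ext fun w => Subtype.ext <| by
        have : p.rangeRestrict w = w := Subtype.ext (hpr _ w.2)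
        simp [this, hpr' _ (v w).2] }
  rw [φ.finrank_eq, finrank_linearMap, mul_comm]

variable {Q : LooplessQuiver} {W : Type} [AddCommGroup W] [Module ℂ W]

/-- The conclusion of `exists_generic_rep`: the stabilizer of `X` acts trivially on the normal
space to the orbit of `X`. -/
def IsGenericRep (e : Q.V → Module.End ℂ W) (X : Q.A → Module.End ℂ W) : Prop :=
  X ∈ repSpace e ∧ ∀ ξ ∈ repSpace e, ∀ g ∈ levi e, bracket X g = 0 →
    ∃ u ∈ levi e, bracket ξ g = bracket X u

/-- A direct sum decomposition of a generic representation has no extensions. -/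
lemma IsGenericRep.sum_finrank_le [FiniteDimensional ℂ W] {e : Q.V → Module.End ℂ W}
    {X : Q.A → Module.End ℂ W} (hX : IsGenericRep e X) (he : ∀ i, e i * e i = e i)
    {p q : Module.End ℂ W} (hp : p ∈ levi e) (hpp : p * p = p) (hpX : bracket X p = 0)
    (hadd : p + q = 1) :
    ∑ a, finrank ℂ (LinearMap.range (e (Q.tgt a) * q)) *
        finrank ℂ (LinearMap.range (e (Q.src a) * p)) ≤
      ∑ i, finrank ℂ (LinearMap.range (e i * q)) *
        finrank ℂ (LinearMap.range (e i * p)) := by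
  have hpX' : ∀ a, p * X a = X a * p := fun a => by
    simpa [sub_eq_zero] using congrFun hpX a
  have hq : q = 1 - p := eq_sub_of_add_eq' hadd
  have hqX : ∀ a, q * X a = X a * q := fun a => by rw [hq, sub_mul, mul_sub, hpX', one_mul, mul_one]
  have heq : ∀ i, e i * q = q * e i := fun i => by rw [hq, sub_mul, mul_sub, hp i, one_mul, mul_one]
  have hqq : q * q = q := by
    rw [hq, mul_sub, mul_one, sub_mul, hpp, one_mul, sub_self, sub_zero]
  have hpq : p * q = 0 := by rw [hq, mul_sub, hpp]; simp
  have hepi : ∀ i, (e i * p) * (e i * p) = e i * p := fun i => by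
    rw [mul_assoc, ← mul_assoc p, ← hp i, mul_assoc, hpp, ← mul_assoc, he]
  have heqi : ∀ i, (e i * q) * (e i * q) = e i * q := fun i => by
    rw [mul_assoc, ← mul_assoc q, ← heq i, mul_assoc, hqq, ← mul_assoc, he]
  have hl : ∀ a (f : Module.End ℂ W), e (Q.tgt a) * (X a * f) = X a * f := fun a f => by
    rw [← mul_assoc, (hX.1 a).1]
  have hr : ∀ a (f : Module.End ℂ W), X a * (e (Q.src a) * f) = X a * f := fun a f => by
    rw [← mul_assoc, (hX.1 a).2]
  let D₀ : (∀ i, homBlock (e i * q) (e i * p)) →ₗ[ℂ] (Q.A → Module.End ℂ W) :=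
    LinearMap.pi fun a =>
      LinearMap.mulRight ℂ (X a) ∘ₗ (homBlock _ _).subtype ∘ₗ LinearMap.proj (Q.tgt a) -
      LinearMap.mulLeft ℂ (X a) ∘ₗ (homBlock _ _).subtype ∘ₗ LinearMap.proj (Q.src a)
  have hD₀ : ∀ u a, D₀ u a = (u (Q.tgt a)).1 * X a - X a * (u (Q.src a)).1 := fun u a => by
    simp [D₀]
  let T : Submodule ℂ (Q.A → Module.End ℂ W) :=
    Submodule.pi Set.univ fun a => homBlock (e (Q.tgt a) * q) (e (Q.src a) * p)
  have hT : T ≤ LinearMap.range D₀ := by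
    intro η hη
    have hη1 : ∀ a, e (Q.tgt a) * q * η a = η a := fun a => (hη a trivial).1
    have hη2 : ∀ a, η a * (e (Q.src a) * p) = η a := fun a => (hη a trivial).2
    have hηR : η ∈ repSpace e := fun a => by
      constructor
      · rw [← hη1 a, ← mul_assoc, ← mul_assoc, he]
      · rw [← hη2 a, mul_assoc, mul_assoc, ← hp, ← mul_assoc (e _) (e _), he]
    have hqη : ∀ a, q * η a = η a := fun a => by
      rw [← hη1 a, ← mul_assoc, ← mul_assoc, ← heq, mul_assoc (e _) q q, hqq]
    have hηp : ∀ a, η a * p = η a := fun a => by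
      rw [← hη2 a, mul_assoc, mul_assoc, hpp]
    have hpη : ∀ a, p * η a = 0 := fun a => by
      rw [← hqη a, ← mul_assoc, hpq, zero_mul]
    obtain ⟨u, hu, hη⟩ := hX.2 η hηR p hp hpX
    have hua : ∀ a, u * X a - X a * u = - η a := fun a => by
      have := congrFun hη a
      rw [bracket_apply, bracket_apply, hpη, hηp] at this
      rw [← this, zero_sub]
    refine ⟨fun i => ⟨-(e i * q * u * (e i * p)), ?_, ?_⟩, ?_⟩
    · rw [mul_neg, mul_assoc (e i * q) u, ← mul_assoc (e i * q) (e i * q), heqi]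
    · rw [neg_mul, mul_assoc, hepi]
    · funext a
      rw [hD₀]
      have h1 : e (Q.tgt a) * q * u * (e (Q.tgt a) * p) * X a = q * (u * X a) * p := by
        rw [mul_assoc (e _ * q * u), mul_assoc (e _) p, hpX', hl, heq, mul_assoc q, hu,
          mul_assoc q, mul_assoc u, hl, mul_assoc q, mul_assoc u]
      have h2 : X a * (e (Q.src a) * q * u * (e (Q.src a) * p)) = q * (X a * u) * p := by
        rw [mul_assoc (e _), mul_assoc (e _), hr, mul_assoc q, ← mul_assoc u, ← hu,
          ← mul_assoc (X a), ← hqX, mul_assoc q, mul_assoc (e _), hr]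
        simp only [mul_assoc]
      simp only [neg_mul, mul_neg]
      rw [h1, h2, ← hηp a, ← hqη a, ← neg_neg (η a), ← hua]
      simp only [mul_sub, sub_mul, mul_neg, neg_mul, mul_assoc]
      abel
  have hle : finrank ℂ T ≤ finrank ℂ (∀ i, homBlock (e i * q) (e i * p)) :=
    (Submodule.finrank_mono hT).trans (LinearMap.finrank_range_le D₀)
  have hTf : finrank ℂ T = ∑ a, finrank ℂ (homBlock (e (Q.tgt a) * q) (e (Q.src a) * p)) := by
    let ψ : T ≃ₗ[ℂ] (∀ a, homBlock (e (Q.tgt a) * q) (e (Q.src a) * p)) :=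
      { toFun := fun η a => ⟨η.1 a, η.2 a trivial⟩
        invFun := fun η => ⟨fun a => (η a).1, fun a _ => (η a).2⟩
        map_add' := fun _ _ => rfl
        map_smul' := fun _ _ => rfl
        left_inv := fun _ => rfl
        right_inv := fun _ => rfl }
    rw [ψ.finrank_eq, finrank_pi_fintype]
  rw [hTf, finrank_pi_fintype] at hle
  simpa only [finrank_homBlock (heqi _) (hepi _)] using hle

end LooplessQuiver

/-- The quadratic inequality on which the theory of the fundamental region rests. -/
lemma cross_eq_of_sum_le {V A : Type*} [Fintype V] [DecidableEq V] [Fintype A] (s t : A → V)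
    (α β γ : V → ℝ) (hβ : ∀ i, 0 ≤ β i) (hγ : ∀ i, 0 ≤ γ i) (hα : ∀ i, β i + γ i = α i)
    (hF : ∀ i, 2 * α i ≤ ∑ a, ((if s a = i then α (t a) else 0) + if t a = i then α (s a) else 0))
    (hle : ∑ a, (β (s a) * γ (t a) + β (t a) * γ (s a)) ≤ 2 * ∑ i, β i * γ i) (a : A)
    (hs : α (s a) ≠ 0) (ht : α (t a) ≠ 0) : β (s a) / α (s a) = β (t a) / α (t a) := by
  have hα0 : ∀ i, 0 ≤ α i := fun i => by linarith [hβ i, hγ i, hα i]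
  obtain ⟨r, hr⟩ : ∃ r : V → ℝ, ∀ i, r i = β i / α i := ⟨_, fun _ => rfl⟩
  have hβr : ∀ i, β i = r i * α i := fun i => by
    by_cases h : α i = 0
    · have : β i = 0 := by linarith [hβ i, hγ i, hα i]
      rw [this, h, mul_zero]
    · rw [hr, div_mul_cancel₀ _ h]
  have hγr : ∀ i, γ i = (1 - r i) * α i := fun i => by linarith [hα i, hβr i]
  have hf : ∀ i, 0 ≤ r i * (1 - r i) * α i := fun i => by
    rcases (hα0 i).eq_or_lt with h | h
    · rw [← h, mul_zero]
    · have h1 := hβ i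
      have h2 := hγ i
      rw [hβr] at h1
      rw [hγr] at h2
      have h1 := nonneg_of_mul_nonneg_left h1 h
      have h2 := nonneg_of_mul_nonneg_left h2 h
      positivity
  have hsum : ∑ a, (β (s a) * γ (t a) + β (t a) * γ (s a)) =
      ∑ i, (r i * (1 - r i) * α i) *
        (∑ a, ((if s a = i then α (t a) else 0) + if t a = i then α (s a) else 0)) +
      ∑ a, α (s a) * α (t a) * (r (s a) - r (t a)) ^ 2 := by
    simp only [Finset.mul_sum]
    rw [Finset.sum_comm, ← Finset.sum_add_distrib]
    refine Finset.sum_congr rfl fun a _ => ?_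
    simp only [mul_add, mul_ite, mul_zero, Finset.sum_add_distrib, Finset.sum_ite_eq,
      Finset.mem_univ, if_true]
    rw [hβr, hβr (t a), hγr, hγr (s a)]
    ring
  have h1 : ∑ i, (r i * (1 - r i) * α i) * (2 * α i) ≤ ∑ i, (r i * (1 - r i) * α i) *
        (∑ a, ((if s a = i then α (t a) else 0) + if t a = i then α (s a) else 0)) :=
    Finset.sum_le_sum fun i _ => mul_le_mul_of_nonneg_left (hF i) (hf i)
  have h2 : 2 * ∑ i, β i * γ i = ∑ i, (r i * (1 - r i) * α i) * (2 * α i) := by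
    rw [Finset.mul_sum]
    refine Finset.sum_congr rfl fun i _ => ?_
    rw [hβr, hγr]
    ring
  have h3 : ∀ a ∈ Finset.univ, 0 ≤ α (s a) * α (t a) * (r (s a) - r (t a)) ^ 2 := fun a _ =>
    mul_nonneg (mul_nonneg (hα0 _) (hα0 _)) (sq_nonneg _)
  have h4 : ∑ a, α (s a) * α (t a) * (r (s a) - r (t a)) ^ 2 = 0 :=
    le_antisymm (by linarith) (Finset.sum_nonneg h3)
  have h5 := (Finset.sum_eq_zero_iff_of_nonneg h3).mp h4 a (Finset.mem_univ a)
  have h6 : r (s a) - r (t a) = 0 := by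
    simpa [hs, ht] using h5
  rw [← hr, ← hr]
  linarith

section TraceForm

open Module

variable {W : Type*} [AddCommGroup W] [Module ℂ W] [FiniteDimensional ℂ W]

lemma eq_zero_of_trace_mul_eq_zero {y : Module.End ℂ W}
    (h : ∀ g : Module.End ℂ W, LinearMap.trace ℂ W (y * g) = 0) : y = 0 := by
  refine LinearMap.ext fun w => ?_
  rw [LinearMap.zero_apply, ← Module.forall_dual_apply_eq_zero_iff ℂ]
  intro f
  have h1 : y * (f.smulRight w : W →ₗ[ℂ] W) = f.smulRight (y w) :=
    LinearMap.ext fun v => by simp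
  have := h (f.smulRight w)
  rwa [h1, LinearMap.trace_smulRight] at this

lemma exists_eq_trace_mul (φ : Module.End ℂ W →ₗ[ℂ] ℂ) :
    ∃ y : Module.End ℂ W, ∀ g, φ g = LinearMap.trace ℂ W (y * g) := by
  let T : Module.End ℂ W →ₗ[ℂ] Module.Dual ℂ (Module.End ℂ W) :=
    (LinearMap.mul ℂ (Module.End ℂ W)).compr₂ (LinearMap.trace ℂ W)
  have hT : Function.Injective T := by
    rw [injective_iff_map_eq_zero]
    exact fun y hy => eq_zero_of_trace_mul_eq_zero fun g => LinearMap.congr_fun hy g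
  have hsurj : Function.Surjective T :=
    (LinearMap.injective_iff_surjective_of_finrank_eq_finrank Subspace.dual_finrank_eq.symm).mp hT
  obtain ⟨y, hy⟩ := hsurj φ
  exact ⟨y, fun g => by rw [← hy]; rfl⟩

end TraceForm

/-- If an endomorphism is not nilpotent up to a scalar, then some polynomial in it is a
nontrivial idempotent. -/
lemma exists_isNilpotent_sub_of_idempotent {W : Type*} [AddCommGroup W] [Module ℂ W]
    [FiniteDimensional ℂ W] [Nontrivial W] (g : Module.End ℂ W)
    (h : ∀ P : Polynomial ℂ, Polynomial.aeval g P * Polynomial.aeval g P = Polynomial.aeval g P →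
      Polynomial.aeval g P = 0 ∨ Polynomial.aeval g P = 1) :
    ∃ μ : ℂ, IsNilpotent (g - algebraMap ℂ _ μ) := by
  obtain ⟨μ, hμ⟩ := Module.End.exists_eigenvalue g
  have hm : minpoly ℂ g ≠ 0 := minpoly.ne_zero (Algebra.IsIntegral.isIntegral g)
  obtain ⟨r, hr, hdvd⟩ := Polynomial.exists_eq_pow_rootMultiplicity_mul_and_not_dvd _ hm μ
  obtain ⟨k, hk⟩ : ∃ k, k = (minpoly ℂ g).rootMultiplicity μ := ⟨_, rfl⟩
  rw [← hk] at hr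
  have hcop : IsCoprime ((Polynomial.X - Polynomial.C μ) ^ k) r :=
    IsCoprime.pow_left
      (((Polynomial.irreducible_X_sub_C μ).coprime_iff_not_dvd).mpr hdvd)
  obtain ⟨a, b, hab⟩ := hcop
  have hzero : Polynomial.aeval g ((Polynomial.X - Polynomial.C μ) ^ k * r) = 0 := by
    rw [← hr, minpoly.aeval]
  have hidem : Polynomial.aeval g (b * r) * Polynomial.aeval g (b * r) =
      Polynomial.aeval g (b * r) := by
    have : b * r * (b * r) = b * r - a * b * ((Polynomial.X - Polynomial.C μ) ^ k * r) := by
      linear_combination (b * r) * hab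
    rw [← map_mul, this, map_sub, map_mul _ (a * b), hzero, mul_zero, sub_zero]
  have hne : Polynomial.aeval g (b * r) ≠ 0 := by
    intro h0
    have hkpos : k ≠ 0 := by
      have : (minpoly ℂ g).IsRoot μ := Module.End.isRoot_of_hasEigenvalue hμ
      rw [hk]
      exact ((Polynomial.rootMultiplicity_pos hm).mpr this).ne'
    have h1 : Polynomial.aeval g (a * (Polynomial.X - Polynomial.C μ) ^ k) = 1 := by
      have := congrArg (Polynomial.aeval g) hab
      rwa [map_add, h0, add_zero, map_one] at this
    obtain ⟨v, hv⟩ := hμ.exists_hasEigenvector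
    have h2 := Module.End.aeval_apply_of_hasEigenvector (p := a * (Polynomial.X - Polynomial.C μ) ^ k) hv
    rw [h1] at h2
    simp only [Module.End.one_apply, Polynomial.eval_mul, Polynomial.eval_pow,
      Polynomial.eval_sub, Polynomial.eval_X, Polynomial.eval_C, sub_self, zero_pow hkpos,
      mul_zero, zero_smul] at h2
    exact hv.2 h2
  have hone := (h _ hidem).resolve_left hne
  refine ⟨μ, k, ?_⟩
  have h3 : (Polynomial.X - Polynomial.C μ) ^ k * (b * r) =
      b * ((Polynomial.X - Polynomial.C μ) ^ k * r) := by ring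
  have h4 := congrArg (Polynomial.aeval g) h3
  rw [map_mul, hone, map_mul _ b, hzero, mul_zero, mul_one] at h4
  simpa using h4

lemma commute_aeval {R : Type*} [Ring R] [Algebra ℂ R] {g h : R} (hgh : g * h = h * g)
    (P : Polynomial ℂ) : Polynomial.aeval g P * h = h * Polynomial.aeval g P := by
  induction P using Polynomial.induction_on' with
  | add p q hp hq => rw [map_add, add_mul, mul_add, hp, hq]
  | monomial n c =>
    rw [Polynomial.aeval_monomial, mul_assoc, (Commute.pow_left hgh n).eq, ← mul_assoc,
      Algebra.commutes, mul_assoc]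

namespace LooplessQuiver

open Module

variable {Q : LooplessQuiver} {W : Type} [AddCommGroup W] [Module ℂ W] [FiniteDimensional ℂ W]

/-- A representation of `Q` lifts to a representation of the deformed preprojective algebra
as soon as the weight pairs to zero with its endomorphisms. -/
lemma exists_isDeformedRep {lam : Q.V → ℂ} {e : Q.V → Module.End ℂ W}
    (hmul : ∀ i j, e i * e j = if i = j then e i else 0) (hsum : ∑ i, e i = 1)
    {X : Q.A → Module.End ℂ W} (hX : X ∈ repSpace e)
    (htr : ∀ g ∈ levi e, bracket X g = 0 →
      LinearMap.trace ℂ W ((∑ i, lam i • e i) * g) = 0) :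
    ∃ x, IsDeformedRep lam e x := by
  obtain ⟨Λ, hΛ⟩ : ∃ Λ, Λ = ∑ i, lam i • e i := ⟨_, rfl⟩
  have hee : ∀ i, e i * e i = e i := fun i => by rw [hmul, if_pos rfl]
  let d := (bracket X).domRestrict (levi e)
  let φ : Module.Dual ℂ (levi e) :=
    LinearMap.trace ℂ W ∘ₗ LinearMap.mulLeft ℂ Λ ∘ₗ (levi e).subtype
  have hφ : φ ∈ LinearMap.range d.dualMap := by
    rw [LinearMap.range_dualMap_eq_dualAnnihilator_ker, Submodule.mem_dualAnnihilator]
    intro g hg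
    have := htr g.1 g.2 hg
    rw [← hΛ] at this
    exact this
  obtain ⟨ψ, hψ⟩ := hφ
  classical
  choose y hy using fun a => exists_eq_trace_mul (W := W)
    (ψ ∘ₗ LinearMap.single ℂ (fun _ : Q.A => Module.End ℂ W) a)
  have hψy : ∀ η : Q.A → Module.End ℂ W, ψ η = ∑ a, LinearMap.trace ℂ W (y a * η a) := by
    intro η
    conv_lhs => rw [← Finset.univ_sum_single η]
    rw [map_sum]
    exact Finset.sum_congr rfl fun a _ => hy a (η a)
  have hφy : ∀ g ∈ levi e, LinearMap.trace ℂ W (Λ * g) =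
      ∑ a, LinearMap.trace ℂ W (y a * (g * X a - X a * g)) := by
    intro g hg
    have h1 := LinearMap.congr_fun hψ ⟨g, hg⟩
    rw [LinearMap.dualMap_apply, hψy] at h1
    simpa [φ, d] using h1.symm
  let Y : Q.A → Module.End ℂ W := fun a => e (Q.src a) * y a * e (Q.tgt a)
  have hY1 : ∀ a, e (Q.src a) * Y a = Y a := fun a => by
    simp only [Y]
    rw [← mul_assoc, ← mul_assoc, hee]
  have hY2 : ∀ a, Y a * e (Q.tgt a) = Y a := fun a => by
    simp only [Y]
    rw [mul_assoc, hee]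
  have hYtr : ∀ g ∈ levi e, ∀ a, LinearMap.trace ℂ W (y a * (g * X a - X a * g)) =
      LinearMap.trace ℂ W ((X a * Y a - Y a * X a) * g) := by
    intro g hg a
    have h1 : g * X a - X a * g =
        e (Q.tgt a) * (g * X a - X a * g) * e (Q.src a) := by
      rw [mul_sub, sub_mul, ← mul_assoc, hg, mul_assoc g, (hX a).1, mul_assoc g, (hX a).2,
        ← mul_assoc (e _), (hX a).1, mul_assoc (X a), ← hg, ← mul_assoc, (hX a).2]
    have h2 : LinearMap.trace ℂ W (Y a * (g * X a)) = LinearMap.trace ℂ W (X a * Y a * g) := by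
      rw [← mul_assoc, LinearMap.trace_mul_comm, ← mul_assoc (X a)]
    calc _ = LinearMap.trace ℂ W
          (y a * (e (Q.tgt a) * (g * X a - X a * g)) * e (Q.src a)) := by rw [mul_assoc, ← h1]
      _ = LinearMap.trace ℂ W (Y a * (g * X a - X a * g)) := by
        rw [LinearMap.trace_mul_comm]
        simp only [Y, mul_assoc]
      _ = _ := by rw [mul_sub, sub_mul, map_sub, map_sub, h2, mul_assoc (Y a)]
  let M : Module.End ℂ W := ∑ a, (X a * Y a - Y a * X a) - Λ
  have hcorner : ∀ i j (U : Module.End ℂ W), e j * U = U → U * e j = U → e i * U = U * e i := by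
    intro i j U h1 h2
    rw [← h1, ← mul_assoc, hmul, h1, ← h2, mul_assoc, hmul]
    by_cases h : i = j
    · subst h
      simp [h1, h2]
    · simp [h, Ne.symm h]
  have hMlevi : ∀ i, e i * M = M * e i := by
    intro i
    have h1 : e i * Λ = Λ * e i := by
      rw [hΛ, Finset.mul_sum, Finset.sum_mul]
      refine Finset.sum_congr rfl fun j _ => ?_
      rw [mul_smul_comm, smul_mul_assoc, hmul, hmul]
      by_cases h : i = j
      · subst h; rfl
      · simp [h, Ne.symm h]
    have h2 : ∀ a, e i * (X a * Y a) = X a * Y a * e i := fun a =>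
      hcorner i (Q.tgt a) _ (by rw [← mul_assoc, (hX a).1]) (by rw [mul_assoc, hY2])
    have h3 : ∀ a, e i * (Y a * X a) = Y a * X a * e i := fun a =>
      hcorner i (Q.src a) _ (by rw [← mul_assoc, hY1]) (by rw [mul_assoc, (hX a).2])
    simp only [M]
    rw [mul_sub, sub_mul, h1, Finset.mul_sum, Finset.sum_mul]
    simp only [mul_sub, sub_mul, h2, h3]
  have hMtr : ∀ g ∈ levi e, LinearMap.trace ℂ W (M * g) = 0 := by
    intro g hg
    simp only [M]
    rw [sub_mul, map_sub, hφy g hg, Finset.sum_mul, map_sum, sub_eq_zero]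
    exact Finset.sum_congr rfl fun a _ => (hYtr g hg a).symm
  have hM : M = 0 := by
    refine eq_zero_of_trace_mul_eq_zero fun η => ?_
    have hlev : ∑ i, e i * η * e i ∈ levi e := fun j => by
      rw [Finset.mul_sum, Finset.sum_mul]
      refine Finset.sum_congr rfl fun i _ => ?_
      rw [← mul_assoc, ← mul_assoc, hmul, mul_assoc (e i * η), hmul]
      by_cases h : i = j
      · subst h; simp
      · simp [h, Ne.symm h]
    rw [← hMtr _ hlev, Finset.mul_sum, map_sum]
    have : ∀ i, LinearMap.trace ℂ W (M * (e i * η * e i)) = LinearMap.trace ℂ W (M * (e i * η)) :=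
      fun i => by
        rw [← mul_assoc, LinearMap.trace_mul_comm, ← mul_assoc, ← mul_assoc, hMlevi,
          mul_assoc M, hee, mul_assoc]
    rw [Finset.sum_congr rfl fun i _ => this i, ← map_sum, ← Finset.mul_sum, ← Finset.sum_mul,
      hsum, one_mul]
  refine ⟨Sum.elim X Y, hmul, hsum, ?_, ?_, ?_⟩
  · rintro (a | a)
    exacts [(hX a).1, hY1 a]
  · rintro (a | a)
    exacts [(hX a).2, hY2 a]
  · rw [← hΛ, ← sub_eq_zero]
    exact hM

end LooplessQuiver

namespace LooplessQuiver

open Module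

section FundamentalRegion

variable {Q : LooplessQuiver} {α : Q.V → ℤ}

/-- A vector proportional to `α` is an integer multiple of `α` if `α` is primitive. -/
lemma exists_eq_smul_of_cross {u : Q.V → ℤ} (hu : ∑ j, u j * α j = 1) {β : Q.V → ℤ}
    (h : ∀ i j, β i * α j = β j * α i) : β = (∑ j, u j * β j) • α := by
  funext i
  calc β i = β i * ∑ j, u j * α j := by rw [hu, mul_one]
    _ = ∑ j, u j * β j * α i := by
      rw [Finset.mul_sum]
      refine Finset.sum_congr rfl fun j _ => ?_
      linear_combination u j * h i j
    _ = _ := by rw [← Finset.sum_mul]; rfl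

variable {W : Type} [AddCommGroup W] [Module ℂ W] [FiniteDimensional ℂ W]
  {e : Q.V → Module.End ℂ W} {X : Q.A → Module.End ℂ W}

/-- For a primitive vector in the fundamental region a generic representation is
indecomposable. -/
lemma IsGenericRep.eq_zero_or_one (hX : IsGenericRep e X)
    (hmul : ∀ i j, e i * e j = if i = j then e i else 0) (hsum : ∑ i, e i = 1)
    (hdim : ∀ i, (finrank ℂ (LinearMap.range (e i)) : ℤ) = α i)
    {u : Q.V → ℤ} (hu : ∑ j, u j * α j = 1) (hconn : Q.SuppConnected α)
    (hform : ∀ i, Q.form α (Q.simRoot i) ≤ 0)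
    {p : Module.End ℂ W} (hp : p ∈ levi e) (hpp : p * p = p) (hpX : bracket X p = 0) :
    p = 0 ∨ p = 1 := by
  have he : ∀ i, e i * e i = e i := fun i => by rw [hmul, if_pos rfl]
  have hq : 1 - p ∈ levi e := sub_mem (fun i => by simp) hp
  have hqq : (1 - p) * (1 - p) = 1 - p := by
    rw [mul_sub, mul_one, sub_mul, hpp, one_mul, sub_self, sub_zero]
  have hqX : bracket X (1 - p) = 0 := by
    rw [map_sub, hpX, sub_zero]
    exact funext fun a => by simp
  obtain ⟨β, hβ⟩ : ∃ β : Q.V → ℕ, ∀ i, β i = finrank ℂ (LinearMap.range (e i * p)) :=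
    ⟨_, fun _ => rfl⟩
  obtain ⟨γ, hγ⟩ : ∃ γ : Q.V → ℕ, ∀ i, γ i = finrank ℂ (LinearMap.range (e i * (1 - p))) :=
    ⟨_, fun _ => rfl⟩
  have hidem : ∀ r ∈ levi e, r * r = r → ∀ i, (e i * r) * (e i * r) = e i * r :=
    fun r hr hrr i => by
      rw [mul_assoc, ← mul_assoc r, ← hr i, mul_assoc, hrr, ← mul_assoc, he]
  have hβγ : ∀ i, (β i : ℤ) + γ i = α i := fun i => by
    have h1 : ((β i : ℂ)) + γ i = (finrank ℂ (LinearMap.range (e i)) : ℂ) := by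
      rw [hβ, hγ, ← trace_eq_finrank_range (hidem p hp hpp i),
        ← trace_eq_finrank_range (hidem _ hq hqq i), ← trace_eq_finrank_range (he i), ← map_add,
        ← mul_add, add_sub_cancel, mul_one]
    rw [← hdim]
    exact_mod_cast h1
  have hle1 := hX.sum_finrank_le he hp hpp hpX (add_sub_cancel _ _)
  have hle2 := hX.sum_finrank_le he hq hqq hqX (sub_add_cancel _ _)
  simp only [← hβ, ← hγ] at hle1 hle2
  have hle : ∑ a, ((β (Q.src a) : ℝ) * γ (Q.tgt a) + β (Q.tgt a) * γ (Q.src a)) ≤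
      2 * ∑ i, (β i : ℝ) * γ i := by
    have h1 : ((∑ a, γ (Q.tgt a) * β (Q.src a) : ℕ) : ℝ) ≤ ((∑ i, γ i * β i : ℕ) : ℝ) :=
      Nat.cast_le.mpr hle1
    have h2 : ((∑ a, β (Q.tgt a) * γ (Q.src a) : ℕ) : ℝ) ≤ ((∑ i, β i * γ i : ℕ) : ℝ) :=
      Nat.cast_le.mpr hle2
    push_cast at h1 h2
    simp only [mul_comm (γ _ : ℝ)] at h1
    rw [Finset.sum_add_distrib]
    linarith
  have hF : ∀ i, 2 * (α i : ℝ) ≤ ∑ a, ((if Q.src a = i then (α (Q.tgt a) : ℝ) else 0) +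
      if Q.tgt a = i then (α (Q.src a) : ℝ) else 0) := fun i => by
    have h1 := hform i
    rw [form_simRoot, Fintype.sum_sum_type, ← Finset.sum_add_distrib] at h1
    simp only [dsrc, dtgt] at h1
    have h2 : 2 * α i ≤ ∑ a, ((if Q.src a = i then α (Q.tgt a) else 0) +
      if Q.tgt a = i then α (Q.src a) else 0) := sub_nonpos.mp h1
    exact_mod_cast h2
  have hratio := cross_eq_of_sum_le Q.src Q.tgt (fun i => (α i : ℝ)) (fun i => (β i : ℝ))
    (fun i => (γ i : ℝ)) (fun _ => Nat.cast_nonneg _) (fun _ => Nat.cast_nonneg _)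
    (fun i => by exact_mod_cast hβγ i) hF hle
  have hpath : ∀ i j, α i ≠ 0 → α j ≠ 0 → (β i : ℝ) / α i = β j / α j := fun i j hi hj => by
    induction hconn i j hi hj with
    | refl => rfl
    | tail _ hstep ih =>
      obtain ⟨⟨a, ⟨rfl, rfl⟩ | ⟨rfl, rfl⟩⟩, h1, h2⟩ := hstep
      · rw [ih h1, hratio a (by exact_mod_cast h1) (by exact_mod_cast h2)]
      · rw [ih h1, hratio a (by exact_mod_cast h2) (by exact_mod_cast h1)]
  have hcross : ∀ i j, (β i : ℤ) * α j = β j * α i := fun i j => by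
    by_cases hi : α i = 0
    · have : (β i : ℤ) = 0 := by have := hβγ i; omega
      rw [hi, this, zero_mul, mul_zero]
    by_cases hj : α j = 0
    · have : (β j : ℤ) = 0 := by have := hβγ j; omega
      rw [hj, this, zero_mul, mul_zero]
    have h1 := hpath i j hi hj
    rw [div_eq_div_iff (by exact_mod_cast hi) (by exact_mod_cast hj)] at h1
    exact_mod_cast h1
  obtain ⟨c, hc⟩ : ∃ c : ℤ, (fun i => (β i : ℤ)) = c • α := ⟨_, exists_eq_smul_of_cross hu hcross⟩
  have hci : ∀ i, (β i : ℤ) = c * α i := fun i => congrFun hc i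
  obtain ⟨j, -, hj⟩ := Finset.exists_ne_zero_of_sum_ne_zero (by rw [hu]; exact one_ne_zero)
  have hjpos : 0 < α j := by
    have := right_ne_zero_of_mul hj
    have := hβγ j
    omega
  have hc0 : 0 ≤ c := by
    by_contra hneg
    have := hci j
    nlinarith
  have hc1 : c ≤ 1 := by
    by_contra hneg
    have := hci j
    have := hβγ j
    nlinarith
  have hrange : ∀ r : Module.End ℂ W, (∀ i, finrank ℂ (LinearMap.range (e i * r)) = 0) → r = 0 := by
    intro r hr
    rw [← one_mul r, ← hsum, Finset.sum_mul]
    exact Finset.sum_eq_zero fun i _ =>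
      LinearMap.range_eq_bot.mp (Submodule.finrank_eq_zero.mp (hr i))
  rcases (show c = 0 ∨ c = 1 by omega) with rfl | rfl
  · left
    refine hrange p fun i => ?_
    have := hci i
    rw [← hβ]
    omega
  · right
    have := hrange (1 - p) fun i => by
      have := hci i
      have := hβγ i
      rw [← hγ]
      omega
    exact (sub_eq_zero.mp this).symm

/-- A primitive vector in the fundamental region is the dimension vector of a deformed
representation of generic weight. -/
lemma hasGenericRep_of_fundamental (hα : ∀ i, 0 ≤ α i) {u : Q.V → ℤ} (hu : ∑ j, u j * α j = 1)
    (hconn : Q.SuppConnected α) (hform : ∀ i, Q.form α (Q.simRoot i) ≤ 0) :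
    HasGenericRep α := by
  obtain ⟨lam, hlam⟩ := exists_isGenericWeight α
  let W : Type := ∀ i, Fin (α i).toNat → ℂ
  let e : Q.V → Module.End ℂ W := fun i =>
    LinearMap.single ℂ (fun i => Fin (α i).toNat → ℂ) i ∘ₗ LinearMap.proj i
  have hmul : ∀ i j, e i * e j = if i = j then e i else 0 := by
    intro i j
    refine LinearMap.ext fun w => ?_
    change (Pi.single i ((Pi.single j (w j) : W) i) : W) = _
    split_ifs with h
    · subst h
      rw [Pi.single_eq_same]
      rfl
    · rw [Pi.single_eq_of_ne h, Pi.single_zero]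
      rfl
  have hsum : ∑ i, e i = 1 := by
    refine LinearMap.ext fun w => ?_
    rw [LinearMap.sum_apply]
    exact Finset.univ_sum_single w
  have hdim : ∀ i, (finrank ℂ (LinearMap.range (e i)) : ℤ) = α i := fun i => by
    have h1 : LinearMap.range (e i) =
        LinearMap.range (LinearMap.single ℂ (fun i => Fin (α i).toNat → ℂ) i) :=
      LinearMap.range_comp_of_range_eq_top _ (LinearMap.range_eq_top.mpr
        (Function.surjective_eval i))
    rw [h1, LinearMap.finrank_range_of_inj
      (Pi.single_injective (M := fun i => Fin (α i).toNat → ℂ) i), finrank_fin_fun,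
      Int.toNat_of_nonneg (hα i)]
  have : Nontrivial W := by
    obtain ⟨j, -, hj⟩ := Finset.exists_ne_zero_of_sum_ne_zero (by rw [hu]; exact one_ne_zero)
    by_contra hW
    rw [not_nontrivial_iff_subsingleton] at hW
    have h1 := hdim j
    rw [finrank_zero_of_subsingleton] at h1
    exact right_ne_zero_of_mul hj h1.symm
  have he : ∀ i, e i * e i = e i := fun i => by rw [hmul, if_pos rfl]
  obtain ⟨X, hXR, hXg⟩ := exists_generic_rep e
  have hX : IsGenericRep e X := ⟨hXR, hXg⟩
  refine ⟨lam, hlam, W, inferInstance, inferInstance, inferInstance, e, ?_⟩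
  have htr : ∀ g ∈ levi e, bracket X g = 0 →
      LinearMap.trace ℂ W ((∑ i, lam i • e i) * g) = 0 := by
    intro g hg hgX
    have hgX' : ∀ a, g * X a = X a * g := fun a => by
      simpa [sub_eq_zero] using congrFun hgX a
    obtain ⟨μ, hμ⟩ := exists_isNilpotent_sub_of_idempotent g fun P hP =>
      hX.eq_zero_or_one hmul hsum hdim hu hconn hform
        (fun i => (commute_aeval (hg i).symm P).symm) hP
        (funext fun a => by rw [bracket_apply, commute_aeval (hgX' a), sub_self]; rfl)
    have hcomm : Commute (∑ i, lam i • e i) (g - algebraMap ℂ _ μ) := by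
      refine Commute.sub_right ?_ (Algebra.commutes μ _).symm
      refine Commute.sum_left _ _ _ fun i _ => Commute.smul_left (hg i) _
    have h1 := LinearMap.isNilpotent_trace_of_isNilpotent (hcomm.isNilpotent_mul_left hμ)
    rw [isNilpotent_iff_eq_zero, mul_sub, map_sub, sub_eq_zero] at h1
    rw [h1, ← Algebra.commutes, ← Algebra.smul_def, map_smul, map_sum]
    simp only [map_smul, trace_eq_finrank_range (he _)]
    have h2 := hlam.1
    have h3 : ∀ i, (finrank ℂ (LinearMap.range (e i)) : ℂ) = α i := fun i => by
      exact_mod_cast congrArg (Int.cast : ℤ → ℂ) (hdim i)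
    simp only [h3, smul_eq_mul] at h2 ⊢
    rw [h2, mul_zero]
  obtain ⟨x, hx⟩ := exists_isDeformedRep hmul hsum hXR htr
  exact ⟨x, hx, hdim⟩

end FundamentalRegion

end LooplessQuiver

/-- The greatest common divisor of a nonzero integral vector, with a Bezout relation. -/
lemma exists_eq_smul_primitive {ι : Type*} [Fintype ι] {α : ι → ℤ} (hα : α ≠ 0) :
    ∃ d : ℤ, 0 < d ∧ ∃ β u : ι → ℤ, α = d • β ∧ ∑ j, u j * β j = 1 := by
  obtain ⟨d, hd⟩ := IsPrincipalIdealRing.principal (Ideal.span (Set.range α))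
  have hd' : Ideal.span (Set.range α) = Ideal.span {|d|} := by
    rw [hd, Ideal.submodule_span_eq, Ideal.span_singleton_eq_span_singleton]
    rw [Int.associated_iff_natAbs, Int.natAbs_abs]
  have hdvd : ∀ i, |d| ∣ α i := fun i => by
    rw [← Ideal.mem_span_singleton, ← hd']
    exact Ideal.subset_span ⟨i, rfl⟩
  choose β hβ using hdvd
  have hd0 : |d| ≠ 0 := fun h => hα (funext fun i => by rw [hβ, h, zero_mul]; rfl)
  obtain ⟨u, hu⟩ := Ideal.mem_span_range_iff_exists_fun.mp
    (hd' ▸ Ideal.mem_span_singleton_self |d|)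
  refine ⟨|d|, lt_of_le_of_ne (abs_nonneg d) hd0.symm, β, u, funext hβ,
    mul_left_cancel₀ hd0 ?_⟩
  rw [mul_one, Finset.mul_sum]
  conv_rhs => rw [← hu]
  refine Finset.sum_congr rfl fun i _ => ?_
  rw [hβ i]
  ring

namespace LooplessQuiver

open Module

variable {Q : LooplessQuiver}

lemma form_smul (c : ℤ) (v : Q.V → ℤ) (i : Q.V) :
    Q.form (c • v) (Q.simRoot i) = c * Q.form v (Q.simRoot i) := by
  have h0 : Q.form 0 (Q.simRoot i) = 0 := by simp [form]
  have := form_sub_smul 0 v (-c) i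
  rwa [neg_smul, sub_neg_eq_add, zero_add, h0, zero_sub, neg_mul, neg_neg] at this

lemma hasGenericRep_simRoot (i : Q.V) : HasGenericRep (Q.simRoot i) := by
  obtain ⟨lam, hlam⟩ := exists_isGenericWeight (Q.simRoot i)
  have hi : lam i = 0 := by
    simpa [simRoot, Pi.single_apply] using hlam.1
  refine ⟨lam, hlam, ℂ, inferInstance, inferInstance, inferInstance,
    fun j => if j = i then 1 else 0, 0, ⟨?_, ?_, ?_, ?_, ?_⟩, fun j => ?_⟩
  · intro j k
    by_cases hj : j = i <;> by_cases hk : k = i <;> simp [hj, hk, Ne.symm]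
  · simp
  · simp
  · simp
  · simp [hi]
  · by_cases hj : j = i
    · subst hj
      beta_reduce
      rw [if_pos rfl, simRoot, Pi.single_eq_same, Module.End.one_eq_id, LinearMap.range_id,
        finrank_top, finrank_self, Nat.cast_one]
    · beta_reduce
      rw [if_neg hj, simRoot, Pi.single_eq_of_ne hj, LinearMap.range_zero, finrank_bot,
        Nat.cast_zero]

lemma IsRoot.exists_hasGenericRep {α : Q.V → ℤ} (hα : Q.IsRoot α) :
    ∃ (m : ℤ) (β : Q.V → ℤ), α = m • β ∧ HasGenericRep β := by
  induction hα with
  | simple i => exact ⟨1, _, (one_smul _ _).symm, hasGenericRep_simRoot i⟩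
  | neg _ ih =>
    obtain ⟨m, β, rfl, hβ⟩ := ih
    exact ⟨-m, β, (neg_smul _ _).symm, hβ⟩
  | reflect i _ ih =>
    obtain ⟨m, β, rfl, hβ⟩ := ih
    have h1 : m • β - Q.form (m • β) (Q.simRoot i) • Q.simRoot i =
        m • (β - Q.form β (Q.simRoot i) • Q.simRoot i) := by
      rw [form_smul, smul_sub, mul_smul]
    rw [h1]
    rcases hβ.reflect i with h | h
    · exact ⟨m, _, rfl, h⟩
    · exact ⟨-m, β, by rw [h, smul_neg, neg_smul], hβ⟩
  | @fundamental α h0 hpos hconn hform =>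
    obtain ⟨d, hd0, β, u, hsmul, hu⟩ := exists_eq_smul_primitive h0
    have hαβ : ∀ i, α i = d * β i := fun i => congrFun hsmul i
    have hne : ∀ i, α i ≠ 0 ↔ β i ≠ 0 := fun i => by
      rw [hαβ i]
      simp [hd0.ne']
    refine ⟨d, β, hsmul, hasGenericRep_of_fundamental (fun i => ?_) hu ?_ fun i => ?_⟩
    · have h1 := hpos i
      rw [hαβ i] at h1
      exact nonneg_of_mul_nonneg_right h1 hd0
    · unfold SuppConnected at hconn ⊢
      simpa only [hne] using hconn
    · have h1 := hform i
      rw [hsmul, form_smul] at h1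
      exact nonpos_of_mul_nonpos_right h1 hd0

end LooplessQuiver

/-- Crawley-Boevey–van den Bergh. Let `Q` be a finite quiver
without loops, let `α` be a positive indivisible root of `Q`, and let
`Z : K(P(Q)-nil) → ℂ` be a central charge which is generic with respect to `α`
(i.e. `Im (Z β / Z α) ≠ 0` for all classes `β` with `0 < β < α`).  Then there is
a stable module in `P(Q)-nil` with respect to `Z` whose class is `α`. -/
theorem exists_stable_module_of_indivisible_root
    (Q : LooplessQuiver) (α : Q.V → ℤ)
    (hroot : Q.IsPositiveRoot α) (hind : Q.Indivisible α)
    (Z : NilCentralCharge Q)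
    (hgen : ∀ β : Q.V → ℤ, (∀ i, 0 ≤ β i) → (∀ i, β i ≤ α i) → β ≠ 0 → β ≠ α →
      (Z.Z β / Z.Z α).im ≠ 0) :
    ∃ M : ModuleCat.{0} Q.Preproj, IsStableMod Z M ∧ Q.dimVec M = α := by
  obtain ⟨hα, hα0, hpos⟩ := hroot
  obtain ⟨m, β, hmβ, hβ⟩ := hα.exists_hasGenericRep
  have hmi : ∀ i, α i = m * β i := fun i => congrFun hmβ i
  have hβpos : ∀ i, 0 ≤ β i := fun i => by
    obtain ⟨_, _, W, _, _, _, e, _, _, hdim⟩ := hβ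
    rw [← hdim]
    exact Nat.cast_nonneg _
  have hβ0 : β ≠ 0 := by
    rintro rfl
    exact hα0 (by rw [hmβ, smul_zero])
  have hm : 1 ≤ m := by
    obtain ⟨j, hj⟩ := Function.ne_iff.mp hα0
    have h1 := hpos j
    have h2 := hβpos j
    have h3 := hmi j
    have hj : α j ≠ 0 := hj
    by_contra hm
    have : α j ≤ 0 := by nlinarith
    omega
  have hβα : β = α := by
    by_contra hne
    refine hgen β hβpos (fun i => ?_) hβ0 hne ?_
    · have := hβpos i
      rw [hmi]
      nlinarith
    · have hZ : Z.Z β ≠ 0 := fun h => by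
        have := (Z.upper β hβpos hβ0).1
        rw [h, Complex.arg_zero] at this
        exact lt_irrefl _ this
      rw [hmβ, map_zsmul, zsmul_eq_mul, div_mul_cancel_right₀ hZ, ← Complex.ofReal_intCast,
        ← Complex.ofReal_inv, Complex.ofReal_im]
  subst hβα
  exact Z.exists_stable_of_hasGenericRep hα0 hgen hβ

end GreenSeqPaper
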